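/- arXiv:1811.12184 — 2 statements merged into one kernel-verified Lean document; each statement's English description precedes it below -/
import Mathlib

section
/- Let G be a finite cut group, D a finite-dimensional division ℚ-algebra, and π : ℚG → D a surjective ℚ-algebra homomorphism. Then either D is commutative, or D is a totally definite quaternion algebra over a totally real number field: the center K of D is a totally real number field and there exist a, b ∈ K with σ(a) < 0 and σ(b) < 0 for every field embedding σ : K → ℝ, together with a K-algebra isomorphism D ≅ ℍ[K,a,b]. -/
open Quaternion

section NumberField

open NumberField

lemma exists_section {Z K : Type*} [CommRing Z] [IsArtinianRing Z] [IsReduced Z] [Field K]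
    (φ : Z →+* K) (hφ : Function.Surjective φ) :
    ∃ s : K →+ Z, (∀ x, φ (s x) = x) ∧ ∀ x y, s (x * y) = s x * s y := by
  have : IsSemisimpleModule Z Z := IsArtinianRing.isSemisimpleRing_of_isReduced Z
  obtain ⟨J, hJ⟩ := (inferInstance : ComplementedLattice (Submodule Z Z)).exists_isCompl
    (RingHom.ker φ)
  have h1 : (1 : Z) ∈ RingHom.ker φ ⊔ J := by rw [hJ.sup_eq_top]; trivial
  obtain ⟨i, hi, e, he, hie⟩ := Submodule.mem_sup.1 h1
  have he0 : ∀ x, φ x = 0 → e * x = 0 := by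
    intro x hx
    have : e * x ∈ RingHom.ker φ ⊓ J :=
      ⟨Ideal.mul_mem_left _ _ hx, Ideal.mul_mem_right _ _ he⟩
    rwa [hJ.inf_eq_bot] at this
  have hφe : φ e = 1 := by
    have := congrArg φ hie
    rw [map_add, map_one, (RingHom.mem_ker).1 hi, zero_add] at this
    exact this
  have hee : ∀ x y, φ x = φ y → e * x = e * y := fun x y h => by
    have := he0 (x - y) (by simp [h])
    rwa [mul_sub, sub_eq_zero] at this
  choose l hl using hφ
  refine ⟨AddMonoidHom.mk' (fun x => e * l x) ?_, ?_, ?_⟩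
  · intro x y
    rw [← mul_add]
    exact hee _ _ (by simp [hl])
  · intro x; simp [hφe, hl]
  · intro x y
    simp only [AddMonoidHom.mk'_apply]
    rw [show e * l x * (e * l y) = e * (e * (l x * l y)) by ring]
    exact hee _ _ (by simp [hl, hφe])

lemma exists_nsmul_mem_of_fg {M Z : Type*} [AddCommGroup M] [Module.Finite ℤ M] [CommRing Z]
    (f : M →+ Z) (R : Subring Z) (hR : ∀ z, ∃ N : ℕ, N ≠ 0 ∧ N • z ∈ R) :
    ∃ N : ℕ, N ≠ 0 ∧ ∀ x, N • f x ∈ R := by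
  obtain ⟨S, hS⟩ := (Module.Finite.fg_top : (⊤ : Submodule ℤ M).FG)
  choose N hN hNR using hR
  refine ⟨∏ x ∈ S, N (f x), Finset.prod_ne_zero_iff.2 fun x _ => hN _, fun x => ?_⟩
  have hx : x ∈ Submodule.span ℤ (S : Set M) := by rw [hS]; trivial
  induction hx using Submodule.span_induction with
  | mem x hx =>
    obtain ⟨c, hc⟩ := Finset.dvd_prod_of_mem (fun x => N (f x)) hx
    rw [hc, mul_comm, mul_smul]
    exact nsmul_mem (hNR _) _
  | zero => simp [R.zero_mem]
  | add x y _ _ hx hy => rw [map_add, nsmul_add]; exact add_mem hx hy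
  | smul a x _ hx => rw [map_zsmul, smul_comm]; exact zsmul_mem hx _

lemma subsingleton_infinitePlace {K : Type*} [Field K] [NumberField K]
    (h : ∀ u : (𝓞 K)ˣ, IsOfFinOrder u) : Subsingleton (InfinitePlace K) := by
  classical
  have h0 : Units.rank K = 0 := by
    rw [← Units.finrank_eq]
    refine Module.finrank_eq_zero_iff_isTorsion.2 ?_
    intro x
    obtain ⟨n, hn, hx⟩ := isOfFinOrder_iff_pow_eq_one.1 (h x.toMul)
    refine ⟨⟨(n : ℤ), mem_nonZeroDivisors_of_ne_zero (by exact_mod_cast hn.ne')⟩, ?_⟩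
    rw [Submonoid.mk_smul, natCast_zsmul]
    exact hx
  rw [Units.rank] at h0
  rw [← Fintype.card_le_one_iff_subsingleton]
  omega

lemma isOfFinOrder_unit_of_finite {Z K : Type*} [CommRing Z] [IsArtinianRing Z] [IsReduced Z]
    [Field K] [NumberField K] (φ : Z →+* K) (hφ : Function.Surjective φ) (R : Subring Z)
    [Finite Rˣ] (hR : ∀ z, ∃ N : ℕ, N ≠ 0 ∧ N • z ∈ R) (u : (𝓞 K)ˣ) : IsOfFinOrder u := by
  obtain ⟨s, hs, hsm⟩ := exists_section φ hφ
  obtain ⟨N, hN, hNR⟩ := exists_nsmul_mem_of_fg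
    (s.comp (algebraMap (𝓞 K) K).toAddMonoidHom) R hR
  have hNs : (N : 𝓞 K) ≠ 0 := by exact_mod_cast hN
  have hfin : Finite (𝓞 K ⧸ Ideal.span {(N : 𝓞 K)}) :=
    Ideal.finiteQuotientOfFreeOfNeBot _ (by simpa using hNs)
  obtain ⟨k, hk, hk1⟩ := isOfFinOrder_iff_pow_eq_one.1
    (isOfFinOrder_of_finite (Units.map (Ideal.Quotient.mk (Ideal.span {(N : 𝓞 K)})).toMonoidHom u))
  have key : ∀ w : (𝓞 K)ˣ, Units.map (Ideal.Quotient.mk (Ideal.span {(N : 𝓞 K)})).toMonoidHom w = 1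
      → ∃ v : 𝓞 K, (w : 𝓞 K) = 1 + N * v := by
    intro w hw
    have := congrArg Units.val hw
    simp only [RingHom.toMonoidHom_eq_coe, Units.coe_map, MonoidHom.coe_coe, Units.val_one] at this
    rw [← map_one (Ideal.Quotient.mk _), Ideal.Quotient.eq, Ideal.mem_span_singleton] at this
    obtain ⟨v, hv⟩ := this
    exact ⟨v, by rw [← hv]; ring⟩
  have hpow : ∀ n : ℤ, ∃ v : 𝓞 K, (((u ^ k) ^ n : (𝓞 K)ˣ) : 𝓞 K) = 1 + N * v := fun n =>
    key _ (by rw [map_zpow, map_pow, hk1, one_zpow])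
  choose v hv using hpow
  let r : ℤ → R := fun n => ⟨1 + N • s (v n), add_mem (one_mem _) (hNR (v n))⟩
  have hφr : ∀ n, φ (r n) = (((u ^ k) ^ n : (𝓞 K)ˣ) : 𝓞 K) := by
    intro n
    simp only [r, hv, map_add, map_one, hs, map_mul, map_natCast, nsmul_eq_mul]
  have hr : ∀ n, r n * r (-n) = 1 := by
    intro n
    apply Subtype.ext
    have h1 : (1 + N * v n) * (1 + N * v (-n)) = 1 := by
      rw [← hv, ← hv, ← Units.val_mul, ← zpow_add, add_neg_cancel, zpow_zero, Units.val_one]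
    have h2 : v n + v (-n) + N * (v n * v (-n)) = 0 := by
      apply mul_left_cancel₀ hNs
      linear_combination h1
    have h3 := congrArg (fun x : 𝓞 K => s (x : K)) h2
    simp only [map_add, map_mul, map_natCast, map_zero] at h3
    rw [← nsmul_eq_mul, map_nsmul, hsm] at h3
    simp only [r, Subring.coe_mul, Subring.coe_one]
    simp only [nsmul_eq_mul] at h3 ⊢
    linear_combination (N : Z) * h3
  let ru : ℤ → Rˣ := fun n => ⟨r n, r (-n), hr n, by simpa using hr (-n)⟩
  obtain ⟨a, b, hab, hne⟩ := Finite.exists_ne_map_eq_of_infinite ru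
  have h2 : (u ^ k) ^ a = (u ^ k) ^ b := by
    apply Units.ext
    apply RingOfIntegers.coe_injective
    refine (hφr a).symm.trans (Eq.trans ?_ (hφr b))
    exact congrArg (fun t : Rˣ => φ (t : R)) hne
  have h3 : IsOfFinOrder (u ^ k) := by
    by_contra h
    exact hab (injective_zpow_iff_not_isOfFinOrder.2 h h2)
  exact (isOfFinOrder_pow.1 h3).resolve_right hk.ne'

lemma embeddings_eq_or_conj {Z K : Type*} [CommRing Z] [IsArtinianRing Z] [IsReduced Z]
    [Field K] [NumberField K] (φ : Z →+* K) (hφ : Function.Surjective φ) (R : Subring Z)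
    [Finite Rˣ] (hR : ∀ z, ∃ N : ℕ, N ≠ 0 ∧ N • z ∈ R) (τ₁ τ₂ : K →+* ℂ) :
    τ₁ = τ₂ ∨ ComplexEmbedding.conjugate τ₁ = τ₂ := by
  have := subsingleton_infinitePlace (isOfFinOrder_unit_of_finite φ hφ R hR)
  exact InfinitePlace.mk_eq_iff.1 (Subsingleton.elim _ _)

lemma embeddings_eq_or_conj_of_isField {Z B : Type*} [CommRing Z] [IsArtinianRing Z] [IsReduced Z]
    [CommRing B] (hB : IsField B) [Algebra ℚ B] [hfin : Module.Finite ℚ B]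
    (φ : Z →+* B) (hφ : Function.Surjective φ) (R : Subring Z)
    [Finite Rˣ] (hR : ∀ z, ∃ N : ℕ, N ≠ 0 ∧ N • z ∈ R) (τ₁ τ₂ : B →+* ℂ) :
    (∀ x, τ₁ x = τ₂ x) ∨ ∀ x, (starRingEnd ℂ) (τ₁ x) = τ₂ x := by
  have := hB.nontrivial
  have hinj := (algebraMap ℚ B).injective
  let _ : Field B := hB.toField
  have : CharZero B := charZero_of_injective_algebraMap hinj
  have : NumberField B :=
    { to_charZero := inferInstance
      to_finiteDimensional := by
        rw [Subsingleton.elim (DivisionRing.toRatAlgebra : Algebra ℚ B) ‹_›]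
        exact hfin }
  rcases embeddings_eq_or_conj φ hφ R hR τ₁ τ₂ with h | h
  · exact Or.inl fun z => RingHom.congr_fun h z
  · exact Or.inr fun z => RingHom.congr_fun h z

/-- If an order in `Z` has finitely many units, then two embeddings of any residue field of `Z`
into `ℂ` coincide up to complex conjugation. -/
lemma comp_eq_or_conj_comp {Z k : Type*} [CommRing Z] [Algebra ℚ Z] [Module.Finite ℚ Z]
    [IsReduced Z] [Field k] [Algebra ℚ k] (φ : Z →ₐ[ℚ] k) (R : Subring Z)
    [Finite Rˣ] (hR : ∀ z, ∃ N : ℕ, N ≠ 0 ∧ N • z ∈ R) (τ₁ τ₂ : k →+* ℂ) :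
    (∀ z, τ₁ (φ z) = τ₂ (φ z)) ∨ ∀ z, (starRingEnd ℂ) (τ₁ (φ z)) = τ₂ (φ z) := by
  have : IsArtinianRing Z := IsArtinianRing.of_finite ℚ Z
  have hfin : Module.Finite ℚ φ.range :=
    Module.Finite.of_surjective φ.rangeRestrict.toLinearMap φ.rangeRestrict_surjective
  have hInt : Algebra.IsIntegral ℚ φ.range := inferInstance
  have hfield : IsField φ.range :=
    (Algebra.IsIntegral.isField_iff_isField (algebraMap ℚ φ.range).injective).1
      (Field.toIsField ℚ)
  rcases embeddings_eq_or_conj_of_isField hfield φ.rangeRestrict.toRingHom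
    φ.rangeRestrict_surjective R hR
    (τ₁.comp φ.range.val.toRingHom) (τ₂.comp φ.range.val.toRingHom) with h | h
  · exact Or.inl fun z => h (φ.rangeRestrict z)
  · exact Or.inr fun z => h (φ.rangeRestrict z)

/-- If the ring homomorphisms `τ₁`, `τ₂` satisfy `τ₁ ζ = τ₂ (ζ ^ a)` on `n`-th roots of unity, the
same relation holds for the traces of `f` and `f ^ a`, whenever `f ^ n = 1`. -/
lemma map_trace_eq_map_trace_pow {k V L : Type*} [Field k] [IsAlgClosed k] [CharZero k]
    [AddCommGroup V] [Module k V] [FiniteDimensional k V] [CommRing L] (τ₁ τ₂ : k →+* L)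
    {n a : ℕ} (hn : n ≠ 0) (hτ : ∀ ζ : k, ζ ^ n = 1 → τ₁ ζ = τ₂ (ζ ^ a))
    (f : Module.End k V) (hf : f ^ n = 1) :
    τ₁ (LinearMap.trace k V f) = τ₂ (LinearMap.trace k V (f ^ a)) := by
  classical
  have hss : f.IsSemisimple := by
    refine Module.End.isSemisimple_of_squarefree_aeval_eq_zero (p := Polynomial.X ^ n - 1) ?_ ?_
    · exact (Polynomial.separable_X_pow_sub_C (1 : k) (by exact_mod_cast hn)
        one_ne_zero).squarefree
    · simp [hf]
  have hInt : DirectSum.IsInternal f.eigenspace :=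
    DirectSum.isInternal_submodule_of_iSupIndep_of_iSup_eq_top f.eigenspaces_iSupIndep
      hss.iSup_eigenspace_eq_top
  have hfin : {μ | f.eigenspace μ ≠ ⊥}.Finite :=
    WellFoundedGT.finite_ne_bot_of_iSupIndep f.eigenspaces_iSupIndep
  have hpow : ∀ (b : ℕ) (μ : k) (v : V), v ∈ f.eigenspace μ → (f ^ b) v = μ ^ b • v := by
    intro b μ v hv
    induction b with
    | zero => simp
    | succ b ih =>
      rw [pow_succ', Module.End.mul_apply, ih, map_smul, Module.End.mem_eigenspace_iff.1 hv,
        smul_smul, pow_succ]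
  have htr : ∀ b : ℕ, LinearMap.trace k V (f ^ b) =
      ∑ μ ∈ hfin.toFinset, μ ^ b * Module.finrank k (f.eigenspace μ) := by
    intro b
    have hmaps : ∀ μ, Set.MapsTo (f ^ b) (f.eigenspace μ) (f.eigenspace μ) := fun μ v hv => by
      rw [SetLike.mem_coe, hpow b μ v hv]
      exact Submodule.smul_mem _ _ hv
    rw [LinearMap.trace_eq_sum_trace_restrict' hInt hfin hmaps]
    refine Finset.sum_congr rfl fun μ _ => ?_
    have : (f ^ b).restrict (hmaps μ) = μ ^ b • LinearMap.id := by
      ext v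
      exact hpow b μ v v.2
    rw [this, map_smul, LinearMap.trace_id, smul_eq_mul]
  have h1 := htr 1
  rw [pow_one] at h1
  rw [h1, htr a, map_sum, map_sum]
  refine Finset.sum_congr rfl fun μ hμ => ?_
  have hμ1 : μ ^ n = 1 := by
    rw [Set.Finite.mem_toFinset, Set.mem_ofPred_eq, Submodule.ne_bot_iff] at hμ
    obtain ⟨v, hv, hv0⟩ := hμ
    have := hpow n μ v hv
    rw [hf, Module.End.one_apply] at this
    exact smul_left_injective k hv0 (by simpa using this.symm)
  simp [hτ μ hμ1]

/-- There is an automorphism of `ℚ̄` raising all `n`-th roots of unity to the `a`-th power. -/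
lemma exists_algEquiv_rootsOfUnity_pow (k : Type*) [Field k] [CharZero k]
    [IsAlgClosure ℚ k] {n a : ℕ} (hn : n ≠ 0) (ha : a.Coprime n) :
    ∃ σ : k ≃ₐ[ℚ] k, ∀ ζ : k, ζ ^ n = 1 → σ ζ = ζ ^ a := by
  have : NeZero n := ⟨hn⟩
  have : IsAlgClosed k := IsAlgClosure.isAlgClosed ℚ
  have : Normal ℚ k := IsAlgClosure.normal ℚ _
  obtain ⟨ζ, hζ⟩ := HasEnoughRootsOfUnity.exists_primitiveRoot k n
  have hc : IsConjRoot ℚ (ζ ^ a) ζ := by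
    rw [isConjRoot_def, ← Polynomial.cyclotomic_eq_minpoly_rat hζ (Nat.pos_of_ne_zero hn),
      ← Polynomial.cyclotomic_eq_minpoly_rat (hζ.pow_of_coprime a ha) (Nat.pos_of_ne_zero hn)]
  obtain ⟨σ, hσ⟩ := isConjRoot_iff_exists_algEquiv.1 hc
  refine ⟨σ, fun ξ hξ => ?_⟩
  obtain ⟨i, -, rfl⟩ := hζ.eq_pow_of_pow_eq_one hξ
  rw [map_pow, hσ, ← pow_mul, ← pow_mul, mul_comm]

namespace MonoidAlgebra

variable {R : Type*} [CommRing R] {G : Type*} [Group G]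

lemma mem_center_of_forall_single {x : MonoidAlgebra R G}
    (h : ∀ g, single g 1 * x = x * single g 1) (y : MonoidAlgebra R G) : y * x = x * y := by
  induction y using MonoidAlgebra.induction_linear with
  | zero => simp
  | add y z hy hz => rw [add_mul, mul_add, hy, hz]
  | single g r =>
    have : single g r = r • (single g 1 : MonoidAlgebra R G) := by simp
    rw [this, smul_mul_assoc, mul_smul_comm, h]

variable [Fintype G]

/-- The sum of all conjugates `h g h⁻¹` of `g`, as `h` runs through `G`. -/
noncomputable def conjSum (R : Type*) [CommRing R] (g : G) : MonoidAlgebra R G :=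
  ∑ h : G, single (h * g * h⁻¹) 1

lemma conjSum_comm (g : G) (y : MonoidAlgebra R G) : y * conjSum R g = conjSum R g * y := by
  refine mem_center_of_forall_single (fun x => ?_) y
  rw [conjSum, Finset.mul_sum, Finset.sum_mul]
  refine Fintype.sum_equiv (Equiv.mulLeft x) _ _ fun h => ?_
  simp [single_mul_single, mul_assoc]

lemma mapRingHom_conjSum {S : Type*} [CommRing S] (f : R →+* S) (g : G) :
    mapRingHom G f (conjSum R g) = conjSum S g := by
  simp [conjSum, map_sum]

lemma coeff_conjSum (g x : G) [DecidableEq G] :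
    (conjSum ℚ g).coeff x = (Finset.univ.filter fun h : G => h * g * h⁻¹ = x).card := by
  simp [conjSum, Finsupp.finsetSum_apply, Finsupp.single_apply]

end MonoidAlgebra

namespace MonoidAlgebra

variable {G : Type*} [Group G]

lemma mapRingHom_comm_of_comm {R S : Type*} [CommRing R] [CommRing S] (f : R →+* S)
    {x : MonoidAlgebra R G} (hx : ∀ y, y * x = x * y) (y : MonoidAlgebra S G) :
    y * mapRingHom G f x = mapRingHom G f x * y := by
  refine mem_center_of_forall_single (fun g => ?_) y
  have := congrArg (mapRingHom G f) (hx (single g 1))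
  simpa [map_mul] using this

lemma mapRingHom_injective {R S : Type*} [CommRing R] [CommRing S] {f : R →+* S}
    (hf : Function.Injective f) : Function.Injective (mapRingHom G f) := by
  intro x y hxy
  ext g
  apply hf
  simpa using congrArg (fun z => z.coeff g) hxy

/-- The rational centre, an order of which is the integral centre. -/
abbrev RatCenter (G : Type*) [Group G] : Type _ :=
  Subalgebra.center ℚ (MonoidAlgebra ℚ G)

/-- The integral elements of the centre of `ℚG`. -/
noncomputable def intCenter (G : Type*) [Group G] : Subring (RatCenter G) :=
  (mapRingHom G (Int.castRingHom ℚ)).range.comap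
    (Subalgebra.center ℚ (MonoidAlgebra ℚ G)).val.toRingHom

lemma exists_nsmul_mem_intCenter [Fintype G] (z : RatCenter G) :
    ∃ N : ℕ, N ≠ 0 ∧ N • z ∈ intCenter G := by
  classical
  refine ⟨∏ g : G, ((z : MonoidAlgebra ℚ G).coeff g).den,
    Finset.prod_ne_zero_iff.2 fun g _ => Rat.den_nz _, ?_⟩
  have h : ∀ g : G, ∃ m : ℤ, ((∏ g : G, ((z : MonoidAlgebra ℚ G).coeff g).den : ℕ) : ℚ) *
      (z : MonoidAlgebra ℚ G).coeff g = m := by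
    intro g
    obtain ⟨c, hc⟩ := Finset.dvd_prod_of_mem
      (fun g => ((z : MonoidAlgebra ℚ G).coeff g).den) (Finset.mem_univ g)
    refine ⟨c * ((z : MonoidAlgebra ℚ G).coeff g).num, ?_⟩
    rw [hc]
    push_cast
    rw [mul_comm (_ : ℚ) (c : ℚ), mul_assoc, Rat.den_mul_eq_num]
  choose m hm using h
  refine ⟨∑ g : G, single g (m g), ?_⟩
  ext g
  have h := hm g
  rw [← nsmul_eq_mul] at h
  simp only [map_sum, AlgHom.toRingHom_eq_coe, RingHom.coe_coe, map_nsmul, Subalgebra.coe_val,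
    coeff_smul, Finsupp.smul_apply, h]
  simp [Finsupp.finsetSum_apply, Finsupp.single_apply]

lemma finite_units_intCenter (h : Finite (↥(Subring.center (MonoidAlgebra ℤ G)))ˣ) :
    Finite (intCenter G)ˣ := by
  have hinj : Function.Injective (mapRingHom G (Int.castRingHom ℚ)) :=
    mapRingHom_injective Int.cast_injective
  have hl : ∀ x : intCenter G, ∃ y : Subring.center (MonoidAlgebra ℤ G),
      mapRingHom G (Int.castRingHom ℚ) y = (x : RatCenter G) := by
    rintro ⟨x, y, hy⟩
    refine ⟨⟨y, Subring.mem_center_iff.2 fun w => hinj ?_⟩, hy⟩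
    rw [map_mul, map_mul]
    have hx := Subalgebra.mem_center_iff.1 x.2 (mapRingHom G (Int.castRingHom ℚ) w)
    have hy' : mapRingHom G (Int.castRingHom ℚ) y = x := hy
    rw [hy', hx]
  choose l hl using hl
  have hlm : ∀ x y, l (x * y) = l x * l y := fun x y => by
    apply Subtype.ext
    apply hinj
    simp [hl, map_mul]
  have hl1 : l 1 = 1 := by
    apply Subtype.ext
    apply hinj
    simp [hl]
  let L : intCenter G →* Subring.center (MonoidAlgebra ℤ G) :=
    { toFun := l, map_one' := hl1, map_mul' := hlm }
  refine Finite.of_injective (Units.map L) ?_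
  intro u v huv
  apply Units.ext
  apply Subtype.ext
  apply Subtype.ext
  have h2 : l u = l v := congrArg Units.val huv
  rw [← hl, ← hl, h2]

lemma isReduced_ratCenter [Fintype G] : IsReduced (RatCenter G) := by
  refine isReduced_iff_pow_one_lt 2 one_lt_two |>.2 fun z hz => ?_
  have hc := Subalgebra.mem_center_iff.1 z.2
  have hz2 : (z : MonoidAlgebra ℚ G) * z = 0 := by
    rw [← sq]; exact congrArg Subtype.val hz
  have h : (z : MonoidAlgebra ℚ G) ∈ Ring.jacobson (MonoidAlgebra ℚ G) := by
    rw [Ring.jacobson, Module.jacobson, Submodule.mem_sInf]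
    intro M hM
    by_contra hzM
    have hlt : M < M ⊔ Submodule.span _ {(z : MonoidAlgebra ℚ G)} :=
      left_lt_sup.2 fun hle => hzM (hle (Submodule.mem_span_singleton_self _))
    have h1 : (1 : MonoidAlgebra ℚ G) ∈ M ⊔ Submodule.span _ {(z : MonoidAlgebra ℚ G)} := by
      rw [hM.2 _ hlt]; trivial
    obtain ⟨m, hm, y, hy, hmy⟩ := Submodule.mem_sup.1 h1
    obtain ⟨a, rfl⟩ := Submodule.mem_span_singleton.1 hy
    apply hzM
    have : (z : MonoidAlgebra ℚ G) = z * m := by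
      calc (z : MonoidAlgebra ℚ G) = z * (m + a • (z : MonoidAlgebra ℚ G)) := by rw [hmy, mul_one]
        _ = z * m + a * (z * z) := by
            rw [mul_add, smul_eq_mul, ← mul_assoc, ← hc a, mul_assoc]
        _ = z * m := by rw [hz2, mul_zero, add_zero]
    rw [this]
    exact M.smul_mem _ hm
  rw [IsSemisimpleRing.jacobson_eq_bot] at h
  exact Subtype.ext h

/-- The central character afforded by a simple module. -/
lemma exists_centralCharacter {k : Type*} [Field k] [IsAlgClosed k] [CharZero k] [Algebra ℚ k]
    (V : Type*) [AddCommGroup V] [Module k V] [Module (MonoidAlgebra k G) V]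
    [IsScalarTower k (MonoidAlgebra k G) V] [FiniteDimensional k V]
    [IsSimpleModule (MonoidAlgebra k G) V] :
    ∃ φ : RatCenter G →ₐ[ℚ] k, ∀ (z : RatCenter G) (v : V),
      mapRingHom G (algebraMap ℚ k) (z : MonoidAlgebra ℚ G) • v = φ z • v := by
  have hs : ∀ z : RatCenter G, ∃ c : k, ∀ v : V,
      mapRingHom G (algebraMap ℚ k) (z : MonoidAlgebra ℚ G) • v = c • v := by
    intro z
    have hz := mapRingHom_comm_of_comm (algebraMap ℚ k) (Subalgebra.mem_center_iff.1 z.2)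
    let f : Module.End (MonoidAlgebra k G) V :=
      { toFun := fun v => mapRingHom G (algebraMap ℚ k) (z : MonoidAlgebra ℚ G) • v
        map_add' := fun v w => smul_add _ _ _
        map_smul' := fun a v => by
          rw [RingHom.id_apply, smul_smul, smul_smul, hz] }
    obtain ⟨c, hc⟩ := (IsSimpleModule.algebraMap_end_bijective_of_isAlgClosed k).2 f
    exact ⟨c, fun v => (LinearMap.congr_fun hc v).symm⟩
  choose φ hφ using hs
  have : Nontrivial V := IsSimpleModule.nontrivial (MonoidAlgebra k G) V
  obtain ⟨v, hv⟩ := exists_ne (0 : V)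
  have huniq : ∀ c d : k, c • v = d • v → c = d := fun c d h => smul_left_injective k hv h
  let Φ : RatCenter G →+* k :=
    { toFun := φ
      map_one' := huniq _ _ (by rw [← hφ]; simp)
      map_zero' := huniq _ _ (by rw [← hφ]; simp)
      map_add' := fun x y => huniq _ _ (by
        rw [← hφ, add_smul, ← hφ, ← hφ, ← add_smul, ← map_add]; rfl)
      map_mul' := fun x y => huniq _ _ (by
        rw [← hφ, mul_smul, ← hφ, ← hφ, ← mul_smul, ← map_mul]; rfl) }
  exact ⟨Φ.toRatAlgHom, fun z v => hφ z v⟩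

variable [Fintype G]

/-- `conjSum` as an element of the centre. -/
noncomputable def centralConjSum (g : G) : RatCenter G :=
  ⟨conjSum ℚ g, Subalgebra.mem_center_iff.2 fun y => conjSum_comm g y⟩

/-- The values of a central character on conjugacy sums are controlled by the action of field
homomorphisms on roots of unity. -/
lemma map_centralCharacter_conjSum {k : Type*} [Field k] [IsAlgClosed k] [CharZero k] [Algebra ℚ k]
    (V : Type*) [AddCommGroup V] [Module k V] [Module (MonoidAlgebra k G) V]
    [IsScalarTower k (MonoidAlgebra k G) V] [FiniteDimensional k V] [Nontrivial V]
    (φ : RatCenter G →ₐ[ℚ] k)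
    (hφ : ∀ (z : RatCenter G) (v : V),
      mapRingHom G (algebraMap ℚ k) (z : MonoidAlgebra ℚ G) • v = φ z • v)
    {L : Type*} [Field L] [CharZero L] (τ₁ τ₂ : k →+* L) (a : ℕ)
    (hτ : ∀ ζ : k, ζ ^ Fintype.card G = 1 → τ₁ ζ = τ₂ (ζ ^ a)) (g : G) :
    τ₁ (φ (centralConjSum g)) = τ₂ (φ (centralConjSum (g ^ a))) := by
  let ρ : MonoidAlgebra k G →ₐ[k] Module.End k V := Algebra.lsmul k k V
  have htr : ∀ x : G, φ (centralConjSum x) * Module.finrank k V =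
      Fintype.card G * LinearMap.trace k V (ρ (single x 1)) := by
    intro x
    have h1 : ρ (conjSum k x) = φ (centralConjSum x) • LinearMap.id := by
      ext v
      rw [← mapRingHom_conjSum (algebraMap ℚ k)]
      exact hφ (centralConjSum x) v
    have h2 := congrArg (LinearMap.trace k V) h1
    rw [map_smul, LinearMap.trace_id, smul_eq_mul] at h2
    rw [← h2, conjSum, map_sum, map_sum]
    have : ∀ h : G, LinearMap.trace k V (ρ (single (h * x * h⁻¹) 1)) =
        LinearMap.trace k V (ρ (single x 1)) := by
      intro h
      have e : (single (h * x * h⁻¹) 1 : MonoidAlgebra k G) =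
        single h 1 * single x 1 * single h⁻¹ 1 := by simp [single_mul_single]
      have e2 : (single h⁻¹ 1 : MonoidAlgebra k G) * (single h 1 * single x 1) = single x 1 := by
        simp [single_mul_single]
      rw [e, map_mul, LinearMap.trace_mul_comm, ← map_mul, e2]
    simp [this]
  have hpow : ∀ b : ℕ, ρ (single (g ^ b) 1) = ρ (single g 1) ^ b := by
    intro b
    rw [← map_pow, single_pow, one_pow]
  have key := map_trace_eq_map_trace_pow τ₁ τ₂ Fintype.card_ne_zero hτ (ρ (single g 1))
    (by rw [← hpow, pow_card_eq_one, ← one_def, map_one])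
  have hd : (Module.finrank k V : L) ≠ 0 := by
    exact_mod_cast (Module.finrank_pos (R := k) (M := V)).ne'
  apply mul_right_cancel₀ hd
  have e1 := congrArg τ₁ (htr g)
  have e2 := congrArg τ₂ (htr (g ^ a))
  simp only [map_mul, map_natCast] at e1 e2
  rw [e1, e2, hpow, key]

lemma centralConjSum_add_eq (h : Finite (↥(Subring.center (MonoidAlgebra ℤ G)))ˣ)
    {a : ℕ} (ha : a.Coprime (Fintype.card G)) (g : G) :
    centralConjSum g + centralConjSum g⁻¹ =
      centralConjSum (g ^ a) + centralConjSum (g ^ a)⁻¹ := by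
  have := isReduced_ratCenter (G := G)
  have := finite_units_intCenter h
  let k := AlgebraicClosure ℚ
  have hk : IsAlgClosure ℚ k := by
    have h0 : @IsAlgClosure ℚ k _ _ (AlgebraicClosure.instAlgebra ℚ) _ := inferInstance
    convert h0
    exact Subsingleton.elim _ _
  obtain ⟨σ, hσ⟩ := exists_algEquiv_rootsOfUnity_pow k (Fintype.card_ne_zero (α := G)) ha
  have halg : Algebra.IsAlgebraic ℚ k := hk.isAlgebraic
  let j : k →ₐ[ℚ] ℂ := IsAlgClosed.lift
  have hconj : ∀ ζ : k, ζ ^ Fintype.card G = 1 →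
      ((starRingEnd ℂ).comp j.toRingHom) ζ = j.toRingHom (ζ ^ (Fintype.card G - 1)) := by
    intro ζ hζ
    have h1 : (j ζ) ^ Fintype.card G = 1 := by rw [← map_pow, hζ, map_one]
    have h2 : ‖j ζ‖ = 1 := Complex.norm_eq_one_of_pow_eq_one h1 Fintype.card_ne_zero
    have h3 : j ζ * j ζ ^ (Fintype.card G - 1) = 1 := by
      rw [← pow_succ', Nat.sub_add_cancel Fintype.card_pos, h1]
    change (starRingEnd ℂ) (j ζ) = j (ζ ^ (Fintype.card G - 1))
    rw [map_pow, ← Complex.inv_eq_conj h2]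
    exact inv_eq_of_mul_eq_one_right h3
  have hinv : ∀ x : G, x ^ (Fintype.card G - 1) = x⁻¹ := fun x => by
    rw [eq_inv_iff_mul_eq_one, ← pow_succ, Nat.sub_add_cancel Fintype.card_pos, pow_card_eq_one]
  have hmem : mapRingHom G (algebraMap ℚ k) ((centralConjSum g + centralConjSum g⁻¹ -
      (centralConjSum (g ^ a) + centralConjSum (g ^ a)⁻¹) : RatCenter G) : MonoidAlgebra ℚ G) ∈
        Ring.jacobson (MonoidAlgebra k G) := by
    rw [Ring.jacobson, Module.jacobson, Submodule.mem_sInf]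
    intro M hM
    have hsimple : IsSimpleModule (MonoidAlgebra k G) (MonoidAlgebra k G ⧸ M) :=
      isSimpleModule_iff_isCoatom.2 hM
    have : Nontrivial (MonoidAlgebra k G ⧸ M) :=
      IsSimpleModule.nontrivial (MonoidAlgebra k G) _
    have : FiniteDimensional k (MonoidAlgebra k G ⧸ M) :=
      Module.Finite.of_surjective (M.mkQ.restrictScalars k) M.mkQ_surjective
    obtain ⟨φ, hφ⟩ := exists_centralCharacter (k := k) (G := G) (MonoidAlgebra k G ⧸ M)
    have hX := map_centralCharacter_conjSum _ φ hφ (j.toRingHom.comp σ.toRingEquiv.toRingHom)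
      j.toRingHom a (fun ζ hζ => congrArg j (hσ ζ hζ))
    have hY := map_centralCharacter_conjSum _ φ hφ ((starRingEnd ℂ).comp j.toRingHom)
      j.toRingHom _ hconj
    simp only [hinv] at hY
    have hj : ∀ x y : k, j.toRingHom x = j.toRingHom y → x = y := fun x y h => j.injective h
    have hzero : φ (centralConjSum g + centralConjSum g⁻¹ -
        (centralConjSum (g ^ a) + centralConjSum (g ^ a)⁻¹)) = 0 := by
      rcases comp_eq_or_conj_comp φ (intCenter G) exists_nsmul_mem_intCenter
        (j.toRingHom.comp σ.toRingEquiv.toRingHom) j.toRingHom with h | h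
      · have e : ∀ x, φ (centralConjSum (x ^ a)) = φ (centralConjSum x) := fun x =>
          hj _ _ (by rw [← hX, h])
        have e' := e g⁻¹
        rw [inv_pow] at e'
        simp [e, e']
      · have e : ∀ x, φ (centralConjSum (x ^ a)⁻¹) = φ (centralConjSum x) := fun x =>
          hj _ _ (by rw [← hY, ← h, hX]; rfl)
        have e' := e g⁻¹
        rw [inv_pow, inv_inv] at e'
        simp [e, e', add_comm]
    have hmk := hφ (centralConjSum g + centralConjSum g⁻¹ -
      (centralConjSum (g ^ a) + centralConjSum (g ^ a)⁻¹)) (Submodule.Quotient.mk (p := M) 1)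
    rw [hzero, zero_smul, ← Submodule.Quotient.mk_smul, Submodule.Quotient.mk_eq_zero,
      smul_eq_mul, mul_one] at hmk
    exact hmk
  rw [IsSemisimpleRing.jacobson_eq_bot, Ideal.mem_bot] at hmem
  have := mapRingHom_injective (algebraMap ℚ k).injective (hmem.trans (map_zero _).symm)
  exact sub_eq_zero.1 (Subtype.ext this)

/-- In a finite group with finitely many central integral units, all generators of a cyclic
subgroup are conjugate up to inversion. -/
theorem exists_conj_eq_pow_or_inv {G : Type*} [Group G] [Finite G]
    (h : Finite (↥(Subring.center (MonoidAlgebra ℤ G)))ˣ)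
    {a : ℕ} (ha : a.Coprime (Nat.card G)) (g : G) :
    ∃ z : G, z * g * z⁻¹ = g ^ a ∨ z * g * z⁻¹ = (g ^ a)⁻¹ := by
  classical
  have := Fintype.ofFinite G
  rw [Nat.card_eq_fintype_card] at ha
  have hsum := congrArg (fun z : RatCenter G => (z : MonoidAlgebra ℚ G).coeff g)
    (centralConjSum_add_eq h ha g)
  change (conjSum ℚ g + conjSum ℚ g⁻¹).coeff g =
    (conjSum ℚ (g ^ a) + conjSum ℚ (g ^ a)⁻¹).coeff g at hsum
  simp only [coeff_add, Finsupp.add_apply, coeff_conjSum] at hsum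
  norm_cast at hsum
  by_contra! hne
  have h1 : (Finset.univ.filter fun z : G => z * g ^ a * z⁻¹ = g) = ∅ := by
    refine Finset.filter_eq_empty_iff.2 fun z _ hz => (hne z⁻¹).1 ?_
    conv_lhs => rw [← hz]
    group
  have h2 : (Finset.univ.filter fun z : G => z * (g ^ a)⁻¹ * z⁻¹ = g) = ∅ := by
    refine Finset.filter_eq_empty_iff.2 fun z _ hz => (hne z⁻¹).2 ?_
    conv_lhs => rw [← hz]
    group
  have h3 : 0 < (Finset.univ.filter fun z : G => z * g * z⁻¹ = g).card :=
    Finset.card_pos.2 ⟨1, by simp⟩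
  rw [h1, h2, Finset.card_empty] at hsum
  omega

end MonoidAlgebra

end NumberField

section Group

variable {G : Type*} [Group G]

lemma conj_pow_eq_zpow {z x : G} {b : ℤ} (h : z * x * z⁻¹ = x ^ b) (k : ℕ) :
    z ^ k * x * (z ^ k)⁻¹ = x ^ b ^ k := by
  induction k with
  | zero => simp
  | succ k ih =>
    calc z ^ (k + 1) * x * (z ^ (k + 1))⁻¹ = z * (z ^ k * x * (z ^ k)⁻¹) * z⁻¹ := by
          rw [pow_succ']; group
      _ = x ^ b ^ (k + 1) := by rw [ih, ← conj_zpow, h, ← zpow_mul, pow_succ']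

lemma exists_not_dvd_pow_pow_eq_one {z : G} (hz : IsOfFinOrder z) {q : ℕ} (hq : q.Prime) :
    ∃ m c, ¬ q ∣ m ∧ (z ^ m) ^ q ^ c = 1 := by
  refine ⟨orderOf z / q ^ (orderOf z).factorization q, (orderOf z).factorization q,
    Nat.not_dvd_ordCompl hq hz.orderOf_pos.ne', ?_⟩
  rw [← pow_mul, Nat.div_mul_cancel (Nat.ordProj_dvd _ _), pow_orderOf_eq_one]

end Group

section DivisionRing

variable {D : Type*} [DivisionRing D]

open scoped IsMulCommutative in
/-- Commuting roots of unity in a division ring behave as in a field. -/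
lemma Commute.exists_eq_pow_of_pow_orderOf_eq_one {x y : Dˣ} (hxy : Commute x y)
    (hx : IsOfFinOrder x) (hy : y ^ orderOf x = 1) : ∃ i : ℕ, y = x ^ i := by
  have hc : ∀ a ∈ ({(x : D), (y : D)} : Set D), ∀ b ∈ ({(x : D), (y : D)} : Set D),
      a * b = b * a := by
    have h : (x : D) * y = y * x := by exact_mod_cast hxy.eq
    rintro a (rfl | rfl) b (rfl | rfl) <;> simp [h]
  let R := Subring.closure ({(x : D), (y : D)} : Set D)
  have : IsMulCommutative R := Subring.isMulCommutative_closure hc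
  let x' : R := ⟨x, Subring.subset_closure (by simp)⟩
  let y' : R := ⟨y, Subring.subset_closure (by simp)⟩
  have hinj : Function.Injective R.subtype := Subtype.val_injective
  have hx' : IsPrimitiveRoot x' (orderOf x) := by
    have : orderOf x' = orderOf x := by
      rw [← orderOf_units, ← orderOf_injective R.subtype.toMonoidHom hinj x']; rfl
    rw [← this]
    exact IsPrimitiveRoot.orderOf x'
  have hy' : y' ^ orderOf x = 1 := hinj (by
    rw [map_pow, map_one]
    change (y : D) ^ orderOf x = 1
    rw [← Units.val_pow_eq_pow_val, hy, Units.val_one])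
  have : NeZero (orderOf x) := ⟨hx.orderOf_pos.ne'⟩
  obtain ⟨i, -, hi⟩ := hx'.eq_pow_of_pow_eq_one hy'
  refine ⟨i, Units.ext ?_⟩
  have := congrArg R.subtype hi
  rw [map_pow] at this
  rw [Units.val_pow_eq_pow_val]
  exact this.symm

/-- A `q`-element acting on a cyclic `q`-subgroup of a division ring, with cohomological
hypothesis `hb` on the exponent, acts trivially. -/
lemma commute_of_conj_eq_zpow {q e c : ℕ} (hq : q.Prime) (he : e ≠ 0) {y w : Dˣ} {b : ℤ}
    (hy : orderOf y = q ^ e) (hw : w ^ q ^ c = 1) (h : w * y * w⁻¹ = y ^ b)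
    (hwq : (q ^ e : ℤ) ∣ b ^ q - 1) (hyq : (q : ℤ) ∣ b - 1)
    (hb : ∀ j : ℤ, (q ^ e : ℤ) ∣ (b - 1) * j →
      ∃ s : ℤ, (q ^ e : ℤ) ∣ s * (∑ i ∈ Finset.range q, b ^ i) + j) :
    w * y * w⁻¹ = y := by
  have hyf : IsOfFinOrder y := orderOf_pos_iff.1 (by rw [hy]; exact pow_pos hq.pos _)
  have hdvd : ∀ k : ℤ, y ^ k = 1 ↔ (q ^ e : ℤ) ∣ k := fun k => by
    rw [← orderOf_dvd_iff_zpow_eq_one, hy]; push_cast; rfl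
  have hcomm : Commute (w ^ q) y := by
    have := conj_pow_eq_zpow h q
    have h1 : y ^ b ^ q = y := by
      have := (hdvd _).2 hwq
      rwa [zpow_sub, zpow_one, mul_inv_eq_one] at this
    rw [h1] at this
    exact mul_inv_eq_iff_eq_mul.1 this
  have hwq1 : (w ^ q) ^ q ^ c = 1 := by rw [← pow_mul, mul_comm, pow_mul, hw, one_pow]
  obtain ⟨d, -, hd⟩ := (Nat.dvd_prime_pow hq).1 (orderOf_dvd_of_pow_eq_one hwq1)
  have hwf : IsOfFinOrder (w ^ q) := orderOf_pos_iff.1 (by rw [hd]; exact pow_pos hq.pos _)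
  rcases le_total e d with hed | hed
  · obtain ⟨i, hi⟩ := hcomm.exists_eq_pow_of_pow_orderOf_eq_one hwf (by
      rw [hd, ← Nat.add_sub_of_le hed, pow_add, pow_mul, ← hy, pow_orderOf_eq_one, one_pow])
    rw [hi, ← pow_mul, mul_inv_eq_iff_eq_mul, ← pow_succ, ← pow_succ']
  obtain ⟨j, hj⟩ := hcomm.symm.exists_eq_pow_of_pow_orderOf_eq_one hyf (by
      rw [hy, ← Nat.add_sub_of_le hed, pow_add, pow_mul, ← hd, pow_orderOf_eq_one, one_pow])
  have h1 : w * y ^ j * w⁻¹ = y ^ j := by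
    rw [← hj, mul_inv_eq_iff_eq_mul, ← pow_succ, ← pow_succ']
  obtain ⟨s, hs⟩ := hb j ((hdvd _).1 (by
    rw [sub_one_mul, zpow_sub, zpow_mul, ← h, mul_inv_eq_one, zpow_natCast, conj_pow, h1,
      zpow_natCast]))
  have h2 : ∀ k : ℕ, (y ^ s * w) ^ k = y ^ (s * ∑ i ∈ Finset.range k, b ^ i) * w ^ k := by
    intro k
    induction k with
    | zero => simp
    | succ k ih =>
      have h3 : w ^ k * y ^ s = y ^ (b ^ k * s) * w ^ k := by
        rw [zpow_mul, ← conj_pow_eq_zpow h k, conj_zpow]; group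
      rw [pow_succ, ih, Finset.sum_range_succ, mul_add, zpow_add, mul_assoc, ← mul_assoc (w ^ k),
        h3, pow_succ, mul_comm s (b ^ k)]
      simp only [mul_assoc]
  have h4 : (y ^ s * w) ^ q = 1 := by
    rw [h2, hj, ← zpow_natCast, ← zpow_add]
    exact (hdvd _).2 hs
  have hqe : q ^ (e - 1) * q = q ^ e := by rw [← pow_succ, Nat.sub_add_cancel (by omega)]
  have h5 : orderOf (y ^ q ^ (e - 1)) = q := by
    rw [orderOf_pow' _ (pow_pos hq.pos _).ne', hy, ← hqe, Nat.gcd_mul_right_left,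
      Nat.mul_div_cancel_left _ (pow_pos hq.pos _)]
  have h6 : w * y ^ q ^ (e - 1) * w⁻¹ = y ^ q ^ (e - 1) := by
    rw [← conj_pow, h, ← zpow_natCast, ← zpow_mul, ← mul_inv_eq_one, ← zpow_natCast, ← zpow_sub,
      hdvd, ← sub_one_mul, mul_comm]
    exact_mod_cast (show ((q ^ e : ℕ) : ℤ) ∣ ((q ^ (e - 1) : ℕ) : ℤ) * (b - 1) by
      rw [← hqe]; push_cast; exact mul_dvd_mul_left _ hyq)
  have h7 : Commute (y ^ q ^ (e - 1)) (y ^ s * w) :=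
    (((Commute.refl y).pow_left _).zpow_right s).mul_right (mul_inv_eq_iff_eq_mul.1 h6).symm
  obtain ⟨i, hi⟩ := h7.exists_eq_pow_of_pow_orderOf_eq_one hyf.pow (by rw [h5, h4])
  have h8 : w = y ^ (-s + ((q ^ (e - 1) * i : ℕ) : ℤ)) := by
    rw [zpow_add, zpow_neg, zpow_natCast, pow_mul, ← hi, inv_mul_cancel_left]
  rw [h8]
  group

end DivisionRing

section PowConj

variable {D : Type*} [DivisionRing D]

/-- Every element of `S` is conjugate within `S`, up to inversion, to every generator of the
cyclic group it spans. -/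
def PowConj {G : Type*} [Group G] (S : Subgroup G) : Prop :=
  ∀ x ∈ S, ∀ a : ℕ, a.Coprime (orderOf x) →
    ∃ z ∈ S, ∃ b : ℤ, (b = a ∨ b = -a) ∧ z * x * z⁻¹ = x ^ b

lemma isOfFinOrder_of_mem {G : Type*} [Group G] {S : Subgroup G} [Finite S] {x : G}
    (hx : x ∈ S) : IsOfFinOrder x :=
  MonoidHom.isOfFinOrder S.subtype (isOfFinOrder_of_finite (⟨x, hx⟩ : S))

lemma zpow_eq_self_iff {G : Type*} [Group G] {x : G} {b : ℤ} :
    x ^ b = x ↔ (orderOf x : ℤ) ∣ b - 1 := by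
  rw [orderOf_dvd_iff_zpow_eq_one, zpow_sub, zpow_one, mul_inv_eq_one]

lemma zpow_eq_zpow_iff_dvd {G : Type*} [Group G] {x : G} {b c : ℤ} :
    x ^ b = x ^ c ↔ (orderOf x : ℤ) ∣ b - c := by
  rw [orderOf_dvd_iff_zpow_eq_one, zpow_sub, mul_inv_eq_one]

/-- If `b ^ 2 ≡ 1`, the action `x ↦ x ^ b` is realised by an element of `2`-power order. -/
lemma exists_two_pow_conj {S : Subgroup Dˣ} [Finite S] {x z : Dˣ} (hz : z ∈ S) {b : ℤ}
    (h : z * x * z⁻¹ = x ^ b) (hb : (orderOf x : ℤ) ∣ b ^ 2 - 1) :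
    ∃ w ∈ S, ∃ c, w ^ 2 ^ c = 1 ∧ w * x * w⁻¹ = x ^ b := by
  obtain ⟨m, c, hm, hc⟩ := exists_not_dvd_pow_pow_eq_one (isOfFinOrder_of_mem hz) Nat.prime_two
  refine ⟨z ^ m, S.pow_mem hz m, c, hc, ?_⟩
  obtain ⟨k, rfl⟩ : ∃ k, m = 2 * k + 1 := ⟨m / 2, by omega⟩
  rw [conj_pow_eq_zpow h, zpow_eq_zpow_iff_dvd, pow_succ, ← sub_one_mul, pow_mul]
  exact (hb.trans (sub_one_dvd_pow_sub_one _ _)).mul_right _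

lemma orderOf_ne_eight {S : Subgroup Dˣ} [Finite S] (hS : PowConj S) {x : Dˣ} (hx : x ∈ S) :
    orderOf x ≠ 8 := by
  intro h8
  obtain ⟨z, hz, b, hb, h⟩ := hS x hx 3 (by rw [h8]; decide)
  obtain ⟨w, -, c, hc, hw⟩ := exists_two_pow_conj hz h (by
    rw [h8]; rcases hb with rfl | rfl <;> norm_num)
  have := commute_of_conj_eq_zpow (e := 3) Nat.prime_two (by norm_num) (by rw [h8]; norm_num) hc hw
    (by rcases hb with rfl | rfl <;> norm_num) (by rcases hb with rfl | rfl <;> norm_num) (by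
      intro j hj
      rcases hb with rfl | rfl
      · refine ⟨-(j / 4), ?_⟩
        norm_num [Finset.sum_range_succ] at hj ⊢
        omega
      · refine ⟨j / 2, ?_⟩
        norm_num [Finset.sum_range_succ] at hj ⊢
        omega)
  rw [hw, zpow_eq_self_iff, h8] at this
  rcases hb with rfl | rfl <;> norm_num at this

lemma sq_dvd_one_add_mul_pow_sub (q c : ℤ) (k : ℕ) : q ^ 2 ∣ (1 + c * q) ^ k - (1 + k * c * q) := by
  induction k with
  | zero => simp
  | succ k ih =>
    obtain ⟨r, hr⟩ := ih
    refine ⟨k * c ^ 2 + r * (1 + c * q), ?_⟩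
    rw [pow_succ, sub_eq_iff_eq_add.1 hr]
    push_cast
    ring

lemma orderOf_ne_prime_sq {S : Subgroup Dˣ} [Finite S] (hS : PowConj S) {x : Dˣ} (hx : x ∈ S)
    {q : ℕ} (hq : q.Prime) (hq2 : q ≠ 2) : orderOf x ≠ q ^ 2 := by
  intro ho
  have hq0 : (q : ℤ) ≠ 0 := by exact_mod_cast hq.ne_zero
  have hqp : Prime (q : ℤ) := Nat.prime_iff_prime_int.1 hq
  obtain ⟨z, hz, b, hb, h⟩ := hS x hx (1 + q) (by
    rw [ho]; exact Nat.Coprime.pow_right 2 (by simp))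
  obtain ⟨m, c, hm, hc⟩ := exists_not_dvd_pow_pow_eq_one (isOfFinOrder_of_mem (S.pow_mem hz 2)) hq
  have h1 : (z ^ 2) ^ m * x * ((z ^ 2) ^ m)⁻¹ = x ^ (1 + ((2 * m : ℕ) : ℤ) * q) := by
    rw [← pow_mul, conj_pow_eq_zpow h, zpow_eq_zpow_iff_dvd, ho]
    have := sq_dvd_one_add_mul_pow_sub q 1 (2 * m)
    have e : b ^ (2 * m) = (1 + 1 * (q : ℤ)) ^ (2 * m) := by
      rcases hb with rfl | rfl
      · simp
      · rw [(even_two_mul m).neg_pow]; simp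
    rw [e]
    simpa using this
  have hcop : ¬ (q : ℤ) ∣ ((2 * m : ℕ) : ℤ) := by
    intro hd
    rcases hq.dvd_mul.1 (by exact_mod_cast hd) with h2 | h2
    · exact hq2 ((Nat.prime_dvd_prime_iff_eq hq Nat.prime_two).1 h2)
    · exact hm h2
  generalize ((2 * m : ℕ) : ℤ) = d at h1 hcop
  have := commute_of_conj_eq_zpow (e := 2) hq (by norm_num) ho hc h1
    (by
      obtain ⟨r, hr⟩ := sq_dvd_one_add_mul_pow_sub q d q
      exact ⟨r + d, by linear_combination hr⟩) ⟨d, by ring⟩ (by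
    intro j hj
    have hj' : (q : ℤ) ∣ j := by
      have : (q : ℤ) ∣ d * j := by
        obtain ⟨r, hr⟩ := hj
        exact ⟨r, mul_left_cancel₀ hq0 (by linear_combination hr)⟩
      exact (hqp.dvd_or_dvd this).resolve_left hcop
    obtain ⟨j, rfl⟩ := hj'
    refine ⟨-j, ?_⟩
    have hN : (q : ℤ) ^ 2 ∣ (∑ i ∈ Finset.range q, (1 + d * q) ^ i) - q := by
      have h2 : (q : ℤ) ^ 2 ∣ ∑ i ∈ Finset.range q, ((1 + d * q) ^ i - (1 + i * d * q)) :=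
        Finset.dvd_sum fun i _ => sq_dvd_one_add_mul_pow_sub q d i
      have h3 : (q : ℤ) ^ 2 ∣ ∑ i ∈ Finset.range q, (i * d * q : ℤ) := by
        obtain ⟨r, hr⟩ := hq.odd_of_ne_two hq2
        have : ∑ i ∈ Finset.range q, (i : ℤ) = q * r := by
          have := Finset.sum_range_id_mul_two q
          have h4 : ∑ i ∈ Finset.range q, i = q * r := by
            have h5 : q - 1 = r * 2 := by omega
            rw [h5, ← mul_assoc] at this
            exact Nat.eq_of_mul_eq_mul_right two_pos this
          rw [← Nat.cast_sum, h4, Nat.cast_mul]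
        rw [← Finset.sum_mul, ← Finset.sum_mul, this]
        exact ⟨r * d, by ring⟩
      obtain ⟨r, hr⟩ := dvd_add h2 h3
      refine ⟨r, ?_⟩
      rw [← hr]
      simp only [Finset.sum_sub_distrib, Finset.sum_add_distrib, Finset.sum_const,
        Finset.card_range, nsmul_eq_mul, mul_one]
      ring
    obtain ⟨r, hr⟩ := hN
    exact ⟨-j * r, by linear_combination -j * hr⟩)
  rw [h1, zpow_eq_self_iff, ho] at this
  obtain ⟨r, hr⟩ := this
  push_cast at hr
  exact hcop ⟨r, mul_left_cancel₀ hq0 (by linear_combination hr)⟩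

lemma commute_of_pow_coprime {G : Type*} [Group G] {x w : G} {m n : ℕ} (hmn : m.Coprime n)
    (hm : Commute (w ^ m) x) (hn : Commute (w ^ n) x) : Commute w x := by
  have h := Nat.gcd_eq_gcd_ab m n
  rw [hmn.gcd_eq_one] at h
  have : w = (w ^ m) ^ (m.gcdA n) * (w ^ n) ^ (m.gcdB n) := by
    rw [← zpow_natCast, ← zpow_natCast, ← zpow_mul, ← zpow_mul, ← zpow_add, ← h]
    simp
  rw [this]
  exact (hm.zpow_left _).mul_left (hn.zpow_left _)

lemma sum_pow_eq_zero {x : D} {n : ℕ} (hx : x ^ n = 1) (h1 : x ≠ 1) :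
    ∑ i ∈ Finset.range n, x ^ i = 0 := by
  have := mul_geom_sum x n
  rw [hx, sub_self] at this
  exact (mul_eq_zero.1 this).resolve_left (sub_ne_zero.2 h1)

/-- There are no Frobenius groups `C_p ⋊ C_q` in a division ring of characteristic zero. -/
lemma commute_of_conj_eq_zpow_of_prime [CharZero D] {p q : ℕ} (hp : p ≠ 0) (hq : q.Prime)
    {x w : Dˣ} {b : ℤ} (hx : x ^ p = 1) (hw : w ^ q = 1) (h : w * x * w⁻¹ = x ^ b) :
    Commute w x := by
  by_contra hne
  have hw1 : (w : D) ≠ 1 := fun h => hne (by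
    rw [show w = 1 from Units.ext h]; exact Commute.one_left x)
  have hsum : ∑ k ∈ Finset.range q, (w : D) ^ k = 0 :=
    sum_pow_eq_zero (by rw [← Units.val_pow_eq_pow_val, hw, Units.val_one]) hw1
  have hconj : ∀ i k : ℕ, x ^ i * w ^ k * (x ^ i)⁻¹ = (x ^ (1 - b ^ k)) ^ i * w ^ k := by
    intro i k
    have h1 : w ^ k * (x ^ i)⁻¹ * (w ^ k)⁻¹ = x ^ (- (b ^ k * i)) := by
      rw [← zpow_natCast x, ← zpow_neg, ← conj_zpow, conj_pow_eq_zpow h, ← zpow_mul]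
      congr 1; ring
    have h2 : (x ^ (1 - b ^ k)) ^ i = x ^ i * x ^ (- (b ^ k * i)) := by
      rw [← zpow_natCast, ← zpow_mul, ← zpow_natCast x, ← zpow_add]
      congr 1; ring
    rw [h2, ← h1]
    group
  have hdouble : ∑ i ∈ Finset.range p, ∑ k ∈ Finset.range q,
      ((x ^ (1 - b ^ k) : Dˣ) : D) ^ i * (w : D) ^ k = 0 := by
    refine Finset.sum_eq_zero fun i _ => ?_
    have : ∀ k, ((x ^ (1 - b ^ k) : Dˣ) : D) ^ i * (w : D) ^ k =
        ((x ^ i : Dˣ) : D) * (w : D) ^ k * ((x ^ i)⁻¹ : Dˣ) := fun k => by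
      exact_mod_cast congrArg Units.val (hconj i k).symm
    simp only [this]
    rw [← Finset.sum_mul, ← Finset.mul_sum, hsum, mul_zero, zero_mul]
  rw [Finset.sum_comm, Finset.sum_eq_single 0] at hdouble
  · simp at hdouble
    exact hp hdouble
  · intro k hk hk0
    rw [← Finset.sum_mul, sum_pow_eq_zero, zero_mul]
    · have : (x ^ (1 - b ^ k)) ^ p = 1 := by
        rw [← zpow_natCast, ← zpow_mul, mul_comm, zpow_mul, zpow_natCast, hx, one_zpow]
      rw [← Units.val_pow_eq_pow_val, this, Units.val_one]
    · intro h1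
      have h1 : x ^ (1 - b ^ k) = 1 := Units.ext h1
      rw [zpow_sub, zpow_one, mul_inv_eq_one] at h1
      have h2 := conj_pow_eq_zpow h k
      rw [← h1] at h2
      refine hne (commute_of_pow_coprime (m := k) (n := q) ?_ (mul_inv_eq_iff_eq_mul.1 h2)
        (by rw [hw]; exact Commute.one_left x))
      exact (Nat.coprime_of_lt_prime hk0 (Finset.mem_range.1 hk) hq).symm
  · intro h0
    exact absurd (Finset.mem_range.2 hq.pos) h0

lemma sq_eq_one_imp {w : Dˣ} (hw : w ^ 2 = 1) : w = 1 ∨ w = -1 := by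
  have : (w : D) * w = 1 := by rw [← Units.val_mul, ← sq, hw, Units.val_one]
  rcases mul_self_eq_one_iff.1 this with h | h
  · exact Or.inl (Units.ext h)
  · exact Or.inr (Units.ext h)

lemma commute_of_sq_eq_one {w : Dˣ} (hw : w ^ 2 = 1) (x : Dˣ) : Commute w x := by
  rcases sq_eq_one_imp hw with rfl | rfl
  · exact Commute.one_left x
  · exact Commute.neg_one_left x

lemma pow_prime_pow_eq_one {S : Subgroup Dˣ} {q e : ℕ} (hq : q.Prime)
    (h : ∀ x ∈ S, orderOf x ≠ q ^ (e + 1)) {x : Dˣ} (hx : x ∈ S) {c : ℕ} (hc : x ^ q ^ c = 1) :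
    x ^ q ^ e = 1 := by
  obtain ⟨d, -, hd⟩ := (Nat.dvd_prime_pow hq).1 (orderOf_dvd_of_pow_eq_one hc)
  by_cases hde : d ≤ e
  · rw [← orderOf_dvd_iff_pow_eq_one, hd]
    exact pow_dvd_pow q hde
  · refine absurd ?_ (h _ (S.pow_mem hx (q ^ (d - (e + 1)))))
    rw [orderOf_pow_of_dvd (pow_pos hq.pos _).ne' (by rw [hd]; exact pow_dvd_pow q (by omega)), hd,
      Nat.pow_div (by omega) hq.pos]
    congr 1; omega

lemma orderOf_ne_prime [CharZero D] {S : Subgroup Dˣ} [Finite S] (hS : PowConj S) {x : Dˣ}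
    (hx : x ∈ S) {p : ℕ} (hp : p.Prime) (hp5 : 5 ≤ p) : orderOf x ≠ p := by
  intro ho
  obtain ⟨z, hz, b, hb, h⟩ := hS x hx 2 (by
    rw [ho]; exact (Nat.coprime_primes Nat.prime_two hp).2 (by omega))
  have hu : z ^ 2 * x * (z ^ 2)⁻¹ = x ^ (4 : ℤ) := by
    rw [conj_pow_eq_zpow h]
    rcases hb with rfl | rfl <;> norm_num
  have hex : ∃ N : ℕ, 0 < N ∧ Commute ((z ^ 2) ^ N) x := by
    obtain ⟨N, hN, h1⟩ := isOfFinOrder_iff_pow_eq_one.1 (isOfFinOrder_of_mem (S.pow_mem hz 2))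
    exact ⟨N, hN, by rw [h1]; exact Commute.one_left x⟩
  classical
  obtain ⟨hN, hNx⟩ := Nat.find_spec hex
  have hmin := fun m => Nat.find_min (H := hex) (m := m)
  generalize Nat.find hex = N at hN hNx hmin
  have hN1 : N ≠ 1 := by
    rintro rfl
    rw [pow_one] at hNx
    rw [mul_inv_eq_of_eq_mul hNx, eq_comm, zpow_eq_self_iff, ho] at hu
    have := Int.le_of_dvd (by norm_num) hu
    omega
  have hq := Nat.minFac_prime hN1
  obtain ⟨M, hM⟩ := Nat.minFac_dvd N
  generalize N.minFac = q at hq hM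
  have hM0 : 0 < M := Nat.pos_of_ne_zero (by rintro rfl; simp at hM; omega)
  have hMN : M < N := by rw [hM]; exact lt_mul_left hM0 hq.one_lt
  obtain ⟨m, c, hm, hc⟩ :=
    exists_not_dvd_pow_pow_eq_one (isOfFinOrder_of_mem (S.pow_mem (S.pow_mem hz 2) M)) hq
  have hvq : Commute (((z ^ 2) ^ M) ^ q) x := by rwa [← pow_mul, mul_comm, ← hM]
  have hw : ¬ Commute (((z ^ 2) ^ M) ^ m) x := fun hw => hmin M hMN ⟨hM0,
    commute_of_pow_coprime (((Nat.Prime.coprime_iff_not_dvd hq).2 hm).symm) hw hvq⟩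
  apply hw
  have hwS : ((z ^ 2) ^ M) ^ m ∈ S := S.pow_mem (S.pow_mem (S.pow_mem hz 2) M) m
  rcases eq_or_ne q 2 with rfl | hq2
  · have h1 : ((z ^ M) ^ m) ^ 2 ^ 2 = 1 := by
      refine pow_prime_pow_eq_one (e := 2) Nat.prime_two (fun y hy => orderOf_ne_eight hS hy)
        (S.pow_mem (S.pow_mem hz M) m) (c := c + 1) ?_
      rw [← hc]
      simp only [← pow_mul]
      congr 1; ring
    refine commute_of_sq_eq_one ?_ x
    rw [← h1]
    simp only [← pow_mul]
    congr 1; ring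
  · have h1 := pow_prime_pow_eq_one (e := 1) hq (fun y hy => orderOf_ne_prime_sq hS hy hq hq2) hwS hc
    rw [pow_one] at h1
    refine commute_of_conj_eq_zpow_of_prime hp.ne_zero hq (by rw [← ho, pow_orderOf_eq_one]) h1
      (b := (4 ^ M) ^ m) ?_
    rw [← pow_mul, conj_pow_eq_zpow hu, pow_mul]

lemma orderOf_ne_twelve [CharZero D] {S : Subgroup Dˣ} [Finite S] (hS : PowConj S) {x : Dˣ}
    (hx : x ∈ S) : orderOf x ≠ 12 := by
  intro ho
  have hxf := isOfFinOrder_of_mem hx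
  obtain ⟨z, hz, b, hb, h⟩ := hS x hx 5 (by rw [ho]; decide)
  obtain ⟨w, hwS, c, hc, hw⟩ := exists_two_pow_conj hz h (by
    rw [ho]; rcases hb with rfl | rfl <;> norm_num)
  have hne : ¬ Commute w x := fun hwx => by
    rw [mul_inv_eq_of_eq_mul hwx, eq_comm, zpow_eq_self_iff, ho] at hw
    rcases hb with rfl | rfl <;> norm_num at hw
  have hw4 : w ^ 2 ^ 2 = 1 :=
    pow_prime_pow_eq_one (e := 2) Nat.prime_two (fun y hy => orderOf_ne_eight hS hy) hwS hc
  have hpow : ∀ k : ℕ, w * x ^ k * w⁻¹ = x ^ (b * k) := fun k => by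
    rw [← conj_pow, hw, ← zpow_natCast, ← zpow_mul]
  have hx3 : orderOf (x ^ 3) = 4 := by
    rw [orderOf_pow_of_dvd (by norm_num) (by rw [ho]; norm_num), ho]
  rcases hb with rfl | rfl
  · have h1 : Commute (x ^ 3) w := by
      have := hpow 3
      rw [zpow_eq_zpow_iff_dvd.2 (show (orderOf x : ℤ) ∣ _ - (3 : ℕ) by
        rw [ho]; norm_num), zpow_natCast] at this
      exact (mul_inv_eq_iff_eq_mul.1 this).symm
    obtain ⟨i, hi⟩ := h1.exists_eq_pow_of_pow_orderOf_eq_one hxf.pow (by rw [hx3]; exact hw4)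
    exact hne (by rw [hi]; exact ((Commute.refl x).pow_left 3).pow_left i)
  · have hj : w ^ 2 = -1 := by
      refine (sq_eq_one_imp (by rw [← pow_mul]; exact hw4)).resolve_left fun h => ?_
      exact hne (commute_of_sq_eq_one h x)
    have hi : (x ^ 3) ^ 2 = -1 := by
      refine (sq_eq_one_imp (by rw [← pow_mul, ← pow_mul, show 3 * (2 * 2) = orderOf x by rw [ho],
        pow_orderOf_eq_one])).resolve_left
        fun h => ?_
      have := orderOf_dvd_of_pow_eq_one h
      rw [hx3] at this
      norm_num at this
    have hij : w * x ^ 3 = - (x ^ 3 * w) := by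
      have h1 := hpow 3
      have h2 : x ^ ((-(5 : ℕ) : ℤ) * (3 : ℕ)) = (x ^ 3) ^ 2 * x ^ 3 := by
        rw [← pow_mul, ← pow_add, ← zpow_natCast, zpow_eq_zpow_iff_dvd, ho]
        norm_num
      rw [h2, hi, mul_inv_eq_iff_eq_mul] at h1
      rw [h1]
      simp
    have hω : Commute w (x ^ 4) := by
      have h1 := hpow 4
      rw [zpow_eq_zpow_iff_dvd.2 (show (orderOf x : ℤ) ∣ _ - (4 : ℕ) by
        rw [ho]; norm_num), zpow_natCast] at h1
      exact mul_inv_eq_iff_eq_mul.1 h1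
    have hω1 : x ^ 4 ≠ 1 := fun h => by
      have := orderOf_dvd_of_pow_eq_one h
      rw [ho] at this
      norm_num at this
    have hsum : ∑ i ∈ Finset.range 3, ((x ^ 4 : Dˣ) : D) ^ i = 0 := by
      refine sum_pow_eq_zero ?_ (fun h => hω1 (Units.ext h))
      have : (x ^ 4) ^ 3 = 1 := by
        rw [← pow_mul, show 4 * 3 = orderOf x by rw [ho], pow_orderOf_eq_one]
      rw [← Units.val_pow_eq_pow_val, this, Units.val_one]
    have hωi : Commute (x ^ 3) (x ^ 4) := (Commute.refl x).pow_pow 3 4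
    replace hi := congrArg Units.val hi
    replace hj := congrArg Units.val hj
    replace hij := congrArg Units.val hij
    replace hω := congrArg Units.val hω.eq
    replace hωi := congrArg Units.val hωi.eq
    have hi0 : ((x ^ 3 : Dˣ) : D) ≠ 0 := Units.ne_zero _
    have hj0 : (w : D) ≠ 0 := Units.ne_zero _
    have hω0 : ((x ^ 4 : Dˣ) : D) ≠ 0 := Units.ne_zero _
    rw [Units.val_pow_eq_pow_val] at hi hj
    rw [Units.val_neg, Units.val_one] at hi hj
    rw [Units.val_neg] at hij
    rw [Units.val_mul, Units.val_mul] at hij hω hωi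
    generalize ((x ^ 3 : Dˣ) : D) = i at *
    generalize ((x ^ 4 : Dˣ) : D) = r at *
    generalize (w : D) = j at *
    rw [Finset.sum_range_succ, Finset.sum_range_succ, Finset.sum_range_one, pow_zero, pow_one]
      at hsum
    have hr3 : r ^ 3 = 1 := by
      have : (r - 1) * (1 + r + r ^ 2) = r ^ 3 - 1 := by noncomm_ring
      rw [hsum, mul_zero] at this
      exact (sub_eq_zero.1 this.symm)
    have hsq : (r * i + r ^ 2 * j) * (r * i + r ^ 2 * j) = 1 := by
      have e1 : r * i * (r * i) = - r ^ 2 := by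
        rw [mul_assoc, ← mul_assoc i, hωi, mul_assoc, ← mul_assoc, ← sq, ← sq, hi, mul_neg_one]
      have hjr2 : j * r ^ 2 = r ^ 2 * j := (show Commute j r from hω).pow_right 2
      have hir2 : i * r ^ 2 = r ^ 2 * i := (show Commute i r from hωi).pow_right 2
      have e2 : r ^ 2 * j * (r ^ 2 * j) = - r := by
        rw [mul_assoc, ← mul_assoc j, hjr2, mul_assoc, ← mul_assoc, ← sq j, hj, mul_neg_one,
          ← pow_add, show 2 + 2 = 3 + 1 from rfl, pow_succ, hr3, one_mul]
      have e3 : r * i * (r ^ 2 * j) = i * j := by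
        rw [mul_assoc, ← mul_assoc i, hir2, mul_assoc, ← mul_assoc, ← pow_succ', hr3, one_mul]
      have e4 : r ^ 2 * j * (r * i) = - (i * j) := by
        rw [mul_assoc, ← mul_assoc j, hω, mul_assoc, ← mul_assoc, ← pow_succ, hr3, one_mul, hij]
      rw [mul_add, add_mul, add_mul, e1, e2, e3, e4]
      have : r ^ 2 = - (1 + r) := eq_neg_of_add_eq_zero_right hsum
      rw [this]
      abel
    have hcomm : i * (r * i + r ^ 2 * j) = (r * i + r ^ 2 * j) * i := by
      rcases mul_self_eq_one_iff.1 hsq with h | h <;> rw [h] <;> simp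
    have hir2 : i * r ^ 2 = r ^ 2 * i := (show Commute i r from hωi).pow_right 2
    rw [mul_add, add_mul, ← mul_assoc, hωi, add_right_inj, ← mul_assoc, hir2, mul_assoc, mul_assoc,
      hij] at hcomm
    have := mul_left_cancel₀ (pow_ne_zero 2 hω0) hcomm
    exact (mul_ne_zero hi0 hj0) (self_eq_neg.1 this)

lemma orderOf_mem_of_powConj [CharZero D] {S : Subgroup Dˣ} [Finite S] (hS : PowConj S) {x : Dˣ}
    (hx : x ∈ S) : orderOf x ∈ ({1, 2, 3, 4, 6} : Set ℕ) := by
  have hpos := (isOfFinOrder_of_mem hx).orderOf_pos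
  have key : ∀ d, d ∣ orderOf x → ∃ y ∈ S, orderOf y = d := by
    rintro d ⟨k, hk⟩
    have hk0 : k ≠ 0 := by rintro rfl; omega
    refine ⟨x ^ k, S.pow_mem hx k, ?_⟩
    rw [orderOf_pow_of_dvd hk0 (by rw [hk]; exact dvd_mul_left _ _), hk,
      Nat.mul_div_cancel _ (Nat.pos_of_ne_zero hk0)]
  have hprime : ∀ m, m ∣ orderOf x → m = 1 ∨ ∃ p k, (p = 2 ∨ p = 3) ∧ m = p * k := by
    intro m hm
    by_cases h1 : m = 1
    · exact Or.inl h1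
    obtain ⟨k, hk⟩ := m.minFac_dvd
    refine Or.inr ⟨m.minFac, k, ?_, hk⟩
    have hp := Nat.minFac_prime h1
    obtain ⟨y, hy, hyo⟩ := key _ (m.minFac_dvd.trans hm)
    by_contra! hne
    refine orderOf_ne_prime hS hy hp ?_ hyo
    have h4 : m.minFac ≠ 4 := fun h => by rw [h] at hp; revert hp; decide
    have := hp.two_le
    omega
  have h8 : ¬ 8 ∣ orderOf x := fun h => by
    obtain ⟨y, hy, hyo⟩ := key _ h
    exact orderOf_ne_eight hS hy hyo
  have h9 : ¬ 9 ∣ orderOf x := fun h => by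
    obtain ⟨y, hy, hyo⟩ := key _ h
    exact orderOf_ne_prime_sq hS hy Nat.prime_three (by norm_num) (by rw [hyo]; norm_num)
  have h12 : ¬ 12 ∣ orderOf x := fun h => by
    obtain ⟨y, hy, hyo⟩ := key _ h
    exact orderOf_ne_twelve hS hy hyo
  simp only [Set.mem_insert_iff, Set.mem_singleton_iff]
  rcases hprime _ dvd_rfl with h | ⟨p, k, hp, h⟩
  · simp [h]
  rcases hprime k ⟨p, by rw [h, mul_comm]⟩ with h' | ⟨p', k', hp', h'⟩
  · rw [h, h']; rcases hp with rfl | rfl <;> simp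
  rcases hprime k' ⟨p * p', by rw [h, h']; ring⟩ with h'' | ⟨p'', k'', hp'', h''⟩
  · subst h' h''
    rcases hp with rfl | rfl <;> rcases hp' with rfl | rfl <;> omega
  · subst h' h''
    rcases hp with rfl | rfl <;> rcases hp' with rfl | rfl <;> rcases hp'' with rfl | rfl <;> omega

/-- Elements of `S` have trace in `{0, 1, -1}`, apart from `1` and `-1`. -/
lemma eq_or_add_inv_mem_of_powConj [CharZero D] [Algebra ℚ D] {S : Subgroup Dˣ} [Finite S]
    (hS : PowConj S) {x : Dˣ} (hx : x ∈ S) : x = 1 ∨ x = -1 ∨ ∃ t : ℚ, (t = 0 ∨ t = 1 ∨ t = -1) ∧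
      (x : D) + ((x⁻¹ : Dˣ) : D) = algebraMap ℚ D t := by
  have hmem := orderOf_mem_of_powConj hS hx
  simp only [Set.mem_insert_iff, Set.mem_singleton_iff] at hmem
  have hpow := pow_orderOf_eq_one x
  have hinv : (x : D) * ((x⁻¹ : Dˣ) : D) = 1 := x.mul_inv
  have hred : ∀ t : D, (x : D) * x + 1 = x * t → (x : D) + ((x⁻¹ : Dˣ) : D) = t := fun t ht =>
    mul_left_cancel₀ x.ne_zero (by rw [mul_add, hinv, ht])
  rcases hmem with h | h | h | h | h
  · exact Or.inl (orderOf_eq_one_iff.1 h)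
  · rw [h] at hpow
    rcases sq_eq_one_imp hpow with h | h
    · exact Or.inl h
    · exact Or.inr (Or.inl h)
  · refine Or.inr (Or.inr ⟨-1, by simp, hred _ ?_⟩)
    have h1 : (x : D) ≠ 1 := fun h1 => by
      rw [show x = 1 from Units.ext h1, orderOf_one] at h
      norm_num at h
    have h2 := sum_pow_eq_zero (x := (x : D)) (n := 3)
      (by rw [← Units.val_pow_eq_pow_val, ← h, hpow, Units.val_one]) h1
    simp only [Finset.sum_range_succ, Finset.sum_range_zero, pow_zero, pow_one, zero_add] at h2
    rw [map_neg, map_one, mul_neg_one, ← sq]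
    rw [eq_neg_iff_add_eq_zero, ← h2]
    abel
  · refine Or.inr (Or.inr ⟨0, by simp, hred _ ?_⟩)
    rw [h, show 4 = 2 * 2 from rfl, pow_mul] at hpow
    have h2 := (sq_eq_one_imp hpow).resolve_left fun h1 => by
      have := orderOf_dvd_of_pow_eq_one h1
      rw [h] at this
      norm_num at this
    rw [← Units.val_mul, ← sq, h2]
    simp
  · refine Or.inr (Or.inr ⟨1, by simp, hred _ ?_⟩)
    rw [h, show 6 = 3 * 2 from rfl, pow_mul] at hpow
    have h2 := (sq_eq_one_imp hpow).resolve_left fun h1 => by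
      have := orderOf_dvd_of_pow_eq_one h1
      rw [h] at this
      norm_num at this
    have h1 : -(x : D) ≠ 1 := fun h1 => by
      rw [show x = -1 from Units.ext (by rw [← neg_neg (x : D), h1]; simp)] at h
      have := orderOf_dvd_of_pow_eq_one (x := (-1 : Dˣ)) (n := 2) (by simp)
      rw [h] at this
      norm_num at this
    have h3 := sum_pow_eq_zero (x := -(x : D)) (n := 3) (by
      rw [neg_pow, ← Units.val_pow_eq_pow_val, h2, Units.val_neg, Units.val_one]; norm_num) h1
    simp only [Finset.sum_range_succ, Finset.sum_range_zero, pow_zero, pow_one, zero_add, neg_sq]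
      at h3
    rw [map_one, mul_one, ← sub_eq_zero, ← h3, sq]
    abel

end PowConj

/-- The image in any group of a finite cut group has the power-conjugacy property. -/
lemma powConj_range {G H : Type*} [Group G] [Finite G] [Group H]
    (h : Finite (↥(Subring.center (MonoidAlgebra ℤ G)))ˣ) (f : G →* H) : PowConj f.range := by
  rintro _ ⟨g, rfl⟩ a ha
  have hdvd : orderOf (f g) ∣ Nat.card G := (orderOf_map_dvd f g).trans (orderOf_dvd_natCard g)
  have : NeZero (Nat.card G) := ⟨Nat.card_pos.ne'⟩
  obtain ⟨u, hu⟩ := ZMod.unitsMap_surjective hdvd (ZMod.unitOfCoprime a ha)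
  have hmod : f g ^ (u : ZMod (Nat.card G)).val = f g ^ a := by
    rw [pow_eq_pow_iff_modEq, ← ZMod.natCast_eq_natCast_iff]
    have := congrArg Units.val hu
    rw [ZMod.unitsMap_val, ZMod.coe_unitOfCoprime] at this
    rw [← this, ZMod.natCast_val]
  obtain ⟨z, hz⟩ := MonoidAlgebra.exists_conj_eq_pow_or_inv h (ZMod.val_coe_unit_coprime u) g
  refine ⟨f z, ⟨z, rfl⟩, ?_⟩
  rcases hz with hz | hz <;> replace hz := congrArg f hz
  · refine ⟨a, Or.inl rfl, ?_⟩
    rw [map_mul, map_mul, map_inv, map_pow, hmod] at hz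
    rw [hz, zpow_natCast]
  · refine ⟨-a, Or.inr rfl, ?_⟩
    rw [map_mul, map_mul, map_inv, map_inv, map_pow, hmod] at hz
    rw [hz, zpow_neg, zpow_natCast]

section Quaternion

variable {D : Type*} [DivisionRing D] {K : Type*} [Field K] [Algebra K D]

lemma mem_span_quaternion_basis [CharZero K] {V : Submodule K D}
    (hV : ∀ x ∈ V, ∀ y ∈ V, ∃ c : K, x * y + y * x = c • (1 : D))
    (hD : ∀ d : D, ∃ c : K, ∃ x ∈ V, d = c • (1 : D) + x) {u v : D} (hu : u ∈ V) (hv : v ∈ V)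
    {α β : K} (hα : α ≠ 0) (hβ : β ≠ 0) (huu : u * u = α • (1 : D)) (hvv : v * v = β • (1 : D))
    (huv : v * u = -(u * v)) (d : D) :
    ∃ a b c e : K, d = a • (1 : D) + b • u + c • v + e • (u * v) := by
  obtain ⟨a, s, hs, rfl⟩ := hD d
  obtain ⟨m, hm⟩ := hV s hs u hu
  obtain ⟨n, hn⟩ := hV s hs v hv
  obtain ⟨s₁, hs₁⟩ : ∃ s₁, s₁ = s - (m / (2 * α)) • u - (n / (2 * β)) • v := ⟨_, rfl⟩
  have hs₁V : s₁ ∈ V := by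
    rw [hs₁]
    exact V.sub_mem (V.sub_mem hs (V.smul_mem _ hu)) (V.smul_mem _ hv)
  have h1 : u * s₁ = -(s₁ * u) := by
    rw [eq_neg_iff_add_eq_zero, hs₁]
    simp only [mul_sub, sub_mul, mul_smul_comm, smul_mul_assoc, huu, huv]
    have : u * s = m • (1 : D) - s * u := eq_sub_of_add_eq' hm
    rw [this, smul_smul, show m / (2 * α) * α = m / 2 by field_simp]
    module
  have h2 : v * s₁ = -(s₁ * v) := by
    rw [eq_neg_iff_add_eq_zero, hs₁]
    simp only [mul_sub, sub_mul, mul_smul_comm, smul_mul_assoc, hvv, huv]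
    have : v * s = n • (1 : D) - s * v := eq_sub_of_add_eq' hn
    rw [this, smul_smul, show n / (2 * β) * β = n / 2 by field_simp]
    module
  have h3 : u * v * s₁ = s₁ * (u * v) := by
    rw [mul_assoc, h2, mul_neg, ← mul_assoc, h1, neg_mul, neg_neg, mul_assoc]
  obtain ⟨c, v', hv', hw⟩ := hD (u * v)
  obtain ⟨c', hc'⟩ := hV v' hv' s₁ hs₁V
  have h4 : (2 : K) • (u * v * s₁) = (2 : K) • (c • s₁) + c' • (1 : D) := by
    rw [← hc']
    have : (2 : K) • (u * v * s₁) = u * v * s₁ + s₁ * (u * v) := by rw [← h3]; module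
    rw [this, hw]
    simp only [add_mul, mul_add, smul_mul_assoc, mul_smul_comm, one_mul, mul_one]
    module
  have h5 : u * (u * v * s₁) = u * v * s₁ * u := by
    calc u * (u * v * s₁) = u * (u * v) * s₁ := (mul_assoc _ _ _).symm
      _ = -(u * v * u) * s₁ := by rw [mul_assoc u v u, huv]; noncomm_ring
      _ = u * v * s₁ * u := by rw [neg_mul, mul_assoc _ u, h1]; noncomm_ring
  have hu0 : u ≠ 0 := by
    rintro rfl
    rw [mul_zero, eq_comm, smul_eq_zero] at huu
    exact huu.elim hα one_ne_zero
  have h6 : c • s₁ = 0 := by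
    have e1 := congrArg (u * ·) h4
    have e2 := congrArg (· * u) h4
    simp only [mul_smul_comm, smul_mul_assoc, mul_add, add_mul, mul_one, one_mul, h5, h1] at e1 e2
    have : (4 : K) • ((c • s₁) * u) = 0 := by
      rw [smul_mul_assoc]
      have := e2.symm.trans e1
      have := sub_eq_zero.2 this
      rw [← this]
      module
    rw [smul_eq_zero] at this
    exact (mul_eq_zero.1 (this.resolve_left (by norm_num))).resolve_right hu0
  have h7 : u * v * s₁ = (c' / 2) • (1 : D) := by
    rw [h6, smul_zero, zero_add] at h4
    rw [div_eq_inv_mul, mul_smul, ← h4, smul_smul]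
    norm_num
  have hww : u * v * (u * v) = (-(α * β)) • (1 : D) := by
    rw [mul_assoc, ← mul_assoc v, huv, neg_mul, mul_neg, mul_assoc, hvv, ← mul_assoc, huu]
    simp [smul_smul, mul_comm]
  have h8 : s₁ = (-(c' / (2 * α * β))) • (u * v) := by
    have e1 : u * v * (u * v * s₁) = (c' / 2) • (u * v) := by rw [h7]; simp
    rw [← mul_assoc, hww, smul_mul_assoc, one_mul] at e1
    have e2 := congrArg ((-(α * β))⁻¹ • ·) e1
    simp only [smul_smul] at e2
    rw [inv_mul_cancel₀ (by simp [hα, hβ]), one_smul] at e2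
    rw [e2]
    congr 1
    field_simp
  refine ⟨a, m / (2 * α), n / (2 * β), -(c' / (2 * α * β)), ?_⟩
  rw [← h8, hs₁]
  abel

/-- A division algebra spanned by an anisotropic quaternion basis is a quaternion algebra. -/
lemma exists_ringEquiv_quaternion [LinearOrder K] [IsStrictOrderedRing K] {u v : D} {α β : K}
    (hα : α < 0) (hβ : β < 0)
    (huu : u * u = α • (1 : D)) (hvv : v * v = β • (1 : D)) (huv : v * u = -(u * v))
    (hspan : ∀ d : D, ∃ a b c e : K, d = a • (1 : D) + b • u + c • v + e • (u * v)) :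
    Set.range (algebraMap K D) = Set.center D ∧
      ∃ e : D ≃+* ℍ[K, α, β], ∀ c : K, e (algebraMap K D c) = algebraMap K ℍ[K, α, β] c := by
  let B : QuaternionAlgebra.Basis D α 0 β :=
    { i := u, j := v, k := u * v
      i_mul_i := by simp [huu]
      j_mul_j := hvv
      i_mul_j := rfl
      j_mul_i := by simp [huv] }
  have hlift : ∀ q : ℍ[K, α, β], B.liftHom q =
      q.re • (1 : D) + q.imI • u + q.imJ • v + q.imK • (u * v) := fun q => by
    rw [← Algebra.algebraMap_eq_smul_one]; rfl
  have hinj : Function.Injective B.liftHom := by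
    refine (injective_iff_map_eq_zero _).2 fun q hq => ?_
    have h1 : q * star q = algebraMap K ℍ[K, α, β]
        (q.re ^ 2 - α * q.imI ^ 2 - β * q.imJ ^ 2 + α * β * q.imK ^ 2) := by
      rw [QuaternionAlgebra.algebraMap_eq]
      ext <;> simp <;> ring
    have h2 := congrArg B.liftHom h1
    rw [map_mul, hq, zero_mul, AlgHom.commutes, eq_comm,
      map_eq_zero_iff _ (algebraMap K D).injective] at h2
    have hαβ : 0 < α * β := mul_pos_of_neg_of_neg hα hβ
    have p1 := mul_nonneg (neg_pos.2 hα).le (sq_nonneg q.imI)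
    have p2 := mul_nonneg (neg_pos.2 hβ).le (sq_nonneg q.imJ)
    have p3 := mul_nonneg hαβ.le (sq_nonneg q.imK)
    have p0 := sq_nonneg q.re
    ext
    · exact pow_eq_zero_iff two_ne_zero |>.1 (by linarith)
    · refine pow_eq_zero_iff two_ne_zero |>.1
        ((mul_eq_zero.1 (?_ : α * q.imI ^ 2 = 0)).resolve_left hα.ne)
      linarith
    · refine pow_eq_zero_iff two_ne_zero |>.1
        ((mul_eq_zero.1 (?_ : β * q.imJ ^ 2 = 0)).resolve_left hβ.ne)
      linarith
    · refine pow_eq_zero_iff two_ne_zero |>.1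
        ((mul_eq_zero.1 (?_ : α * β * q.imK ^ 2 = 0)).resolve_left hαβ.ne')
      linarith
  have hsurj : Function.Surjective B.liftHom := fun d => by
    obtain ⟨a, b, c, e, rfl⟩ := hspan d
    exact ⟨⟨a, b, c, e⟩, hlift _⟩
  let E := AlgEquiv.ofBijective B.liftHom ⟨hinj, hsurj⟩
  refine ⟨Set.Subset.antisymm ?_ fun d hd => ?_, E.symm.toRingEquiv, fun c => E.symm.commutes c⟩
  · rintro _ ⟨c, rfl⟩
    exact Semigroup.mem_center_iff.2 fun x => (Algebra.commutes c x).symm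
  · obtain ⟨q, rfl⟩ := hsurj d
    have hcomm : ∀ p : ℍ[K, α, β], p * q = q * p := fun p => hinj (by
      rw [map_mul, map_mul]
      exact Semigroup.mem_center_iff.1 hd _)
    have hi := hcomm ⟨0, 1, 0, 0⟩
    have hj := hcomm ⟨0, 0, 1, 0⟩
    have e1 := congrArg QuaternionAlgebra.imK hi
    have e2 := congrArg QuaternionAlgebra.imJ hi
    have e3 := congrArg QuaternionAlgebra.imK hj
    simp at e1 e2 e3
    refine ⟨q.re, ?_⟩
    rw [hlift, Algebra.algebraMap_eq_smul_one]
    have f1 : q.imJ = 0 := by linarith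
    have f2 : q.imI = 0 := by linarith
    have f3 : q.imK = 0 := by
      refine (mul_eq_zero.1 (?_ : α * q.imK = 0)).resolve_left hα.ne
      linarith
    simp [f1, f2, f3]

/-- A finite-trace form of the classification: if the `K`-algebra `D` is spanned by a group of
units whose elements other than `1` and `-1` have reduced trace `0`, `1` or `-1`, then `D` is
commutative or a definite quaternion algebra over `K`. -/
lemma comm_or_exists_ringEquiv_quaternion [LinearOrder K] [IsStrictOrderedRing K]
    {S : Subgroup Dˣ} (hS : ∀ x ∈ S, x = 1 ∨ x = -1 ∨ ∃ t : K, (t = 0 ∨ t = 1 ∨ t = -1) ∧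
      (x : D) + ((x⁻¹ : Dˣ) : D) = algebraMap K D t)
    (hspan : Submodule.span K (Units.val '' (S : Set Dˣ)) = (⊤ : Submodule K D)) :
    (∀ x y : D, x * y = y * x) ∨ ∃ α β : K, α < 0 ∧ β < 0 ∧
      Set.range (algebraMap K D) = Set.center D ∧
      ∃ e : D ≃+* ℍ[K, α, β], ∀ c : K, e (algebraMap K D c) = algebraMap K ℍ[K, α, β] c := by
  by_cases hc : ∀ x ∈ S, ∀ y ∈ S, (x : D) * y = y * x
  · left
    have h1 : ∀ d : D, ∀ x ∈ S, d * x = x * d := fun d x hx => by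
      have hd : d ∈ Submodule.span K (Units.val '' (S : Set Dˣ)) := by rw [hspan]; trivial
      induction hd using Submodule.span_induction with
      | mem d h => obtain ⟨y, hy, rfl⟩ := h; exact hc y hy x hx
      | zero => simp
      | add a b _ _ ha hb => rw [add_mul, mul_add, ha, hb]
      | smul c a _ ha => rw [smul_mul_assoc, mul_smul_comm, ha]
    intro a d
    have hd : d ∈ Submodule.span K (Units.val '' (S : Set Dˣ)) := by rw [hspan]; trivial
    induction hd using Submodule.span_induction with
    | mem d h => obtain ⟨y, hy, rfl⟩ := h; exact h1 a y hy
    | zero => simp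
    | add b c _ _ hb hc => rw [add_mul, mul_add, hb, hc]
    | smul c b _ hb => rw [smul_mul_assoc, mul_smul_comm, hb]
  right
  push Not at hc
  obtain ⟨x, hx, y, hy, hxy⟩ := hc
  have htr : ∀ x ∈ S, ∃ t : K, (x : D) + ((x⁻¹ : Dˣ) : D) = t • (1 : D) := fun x hx => by
    rcases hS x hx with rfl | rfl | ⟨t, -, h⟩
    · exact ⟨2, by rw [two_smul]; simp⟩
    · exact ⟨-2, by rw [neg_smul, two_smul]; simp⟩
    · exact ⟨t, by rw [h, Algebra.algebraMap_eq_smul_one]⟩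
  let V := Submodule.span K ((fun x : Dˣ => (x : D) - ((x⁻¹ : Dˣ) : D)) '' (S : Set Dˣ))
  have hVmem : ∀ x ∈ S, (x : D) - ((x⁻¹ : Dˣ) : D) ∈ V := fun x hx =>
    Submodule.subset_span ⟨x, hx, rfl⟩
  have hV : ∀ a ∈ V, ∀ b ∈ V, ∃ c : K, a * b + b * a = c • (1 : D) := by
    intro a ha b hb
    induction ha, hb using Submodule.span_induction₂ with
    | mem_mem a b ha hb =>
      obtain ⟨g, hg, rfl⟩ := ha
      obtain ⟨h, hh, rfl⟩ := hb
      obtain ⟨t₁, h₁⟩ := htr _ (S.mul_mem hg hh)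
      obtain ⟨t₂, h₂⟩ := htr _ (S.mul_mem hh hg)
      obtain ⟨t₃, h₃⟩ := htr _ (S.mul_mem hg (S.inv_mem hh))
      obtain ⟨t₄, h₄⟩ := htr _ (S.mul_mem (S.inv_mem hg) hh)
      refine ⟨t₁ + t₂ - t₃ - t₄, ?_⟩
      rw [sub_smul, sub_smul, add_smul, ← h₁, ← h₂, ← h₃, ← h₄]
      simp only [mul_inv_rev, inv_inv, Units.val_mul]
      noncomm_ring
    | zero_left => exact ⟨0, by simp⟩
    | zero_right => exact ⟨0, by simp⟩
    | add_left a b c _ _ _ ha hb =>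
      obtain ⟨s, hs⟩ := ha
      obtain ⟨t, ht⟩ := hb
      exact ⟨s + t, by rw [add_smul, ← hs, ← ht]; noncomm_ring⟩
    | add_right a b c _ _ _ ha hb =>
      obtain ⟨s, hs⟩ := ha
      obtain ⟨t, ht⟩ := hb
      exact ⟨s + t, by rw [add_smul, ← hs, ← ht]; noncomm_ring⟩
    | smul_left r a b _ _ h =>
      obtain ⟨s, hs⟩ := h
      exact ⟨r * s, by rw [mul_smul, ← hs, smul_mul_assoc, mul_smul_comm, smul_add]⟩
    | smul_right r a b _ _ h =>
      obtain ⟨s, hs⟩ := h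
      exact ⟨r * s, by rw [mul_smul, ← hs, smul_mul_assoc, mul_smul_comm, smul_add]⟩
  have hD : ∀ d : D, ∃ c : K, ∃ a ∈ V, d = c • (1 : D) + a := by
    intro d
    have hd : d ∈ Submodule.span K (Units.val '' (S : Set Dˣ)) := by rw [hspan]; trivial
    induction hd using Submodule.span_induction with
    | mem d h =>
      obtain ⟨g, hg, rfl⟩ := h
      obtain ⟨t, ht⟩ := htr g hg
      refine ⟨t / 2, (1 / 2 : K) • ((g : D) - ((g⁻¹ : Dˣ) : D)), V.smul_mem _ (hVmem g hg), ?_⟩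
      rw [div_eq_inv_mul, mul_smul, ← ht]
      module
    | zero => exact ⟨0, 0, V.zero_mem, by simp⟩
    | add a b _ _ ha hb =>
      obtain ⟨c, v, hv, rfl⟩ := ha
      obtain ⟨c', v', hv', rfl⟩ := hb
      exact ⟨c + c', v + v', V.add_mem hv hv', by module⟩
    | smul r a _ ha =>
      obtain ⟨c, v, hv, rfl⟩ := ha
      exact ⟨r * c, r • v, V.smul_mem r hv, by module⟩
  have hspecial : ∀ g ∈ S, g ≠ 1 → g ≠ -1 → ∃ t : K, (t = 0 ∨ t = 1 ∨ t = -1) ∧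
      ((g⁻¹ : Dˣ) : D) = t • (1 : D) - g := fun g hg h1 h2 => by
    obtain ⟨t, ht, h⟩ := ((hS g hg).resolve_left h1).resolve_left h2
    exact ⟨t, ht, by rw [← Algebra.algebraMap_eq_smul_one, ← h]; abel⟩
  obtain ⟨a, ha, hxa⟩ := hspecial x hx (by rintro rfl; simp at hxy) (by rintro rfl; simp at hxy)
  obtain ⟨b, hb, hyb⟩ := hspecial y hy (by rintro rfl; simp at hxy) (by rintro rfl; simp at hxy)
  obtain ⟨c, hc, hxyc⟩ := hspecial (x * y) (S.mul_mem hx hy)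
    (fun h => hxy (by rw [eq_inv_of_mul_eq_one_left h]; simp))
    (fun h => hxy (by
      rw [show x = -y⁻¹ by rw [← mul_inv_eq_iff_eq_mul.2 (rfl : x * y = x * y), h]; simp]; simp))
  have hxx : (x : D) * x = a • (x : D) - 1 := by
    have := x.mul_inv
    rw [hxa, mul_sub, mul_smul_comm, mul_one] at this
    rw [← this]; abel
  have hyy : (y : D) * y = b • (y : D) - 1 := by
    have := y.mul_inv
    rw [hyb, mul_sub, mul_smul_comm, mul_one] at this
    rw [← this]; abel
  have hyx : (y : D) * x = (c - a * b) • (1 : D) + b • (x : D) + a • (y : D) - x * y := by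
    rw [mul_inv_rev, Units.val_mul, Units.val_mul, hxa, hyb] at hxyc
    simp only [mul_sub, sub_mul, smul_mul_assoc, mul_smul_comm, one_mul, mul_one] at hxyc
    have e : (y : D) * x = (c • (1 : D) - x * y) - a • (b • (1 : D) - y) + b • (x : D) := by
      rw [← hxyc]; abel
    rw [e]; module
  obtain ⟨u, hu⟩ : ∃ u : D, u = (x : D) - ((x⁻¹ : Dˣ) : D) := ⟨_, rfl⟩
  obtain ⟨h, hh⟩ : ∃ h : D, h = (y : D) - ((y⁻¹ : Dˣ) : D) := ⟨_, rfl⟩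
  have huV : u ∈ V := hu ▸ hVmem x hx
  have hhV : h ∈ V := hh ▸ hVmem y hy
  replace hu : u = (2 : K) • (x : D) - a • (1 : D) := by rw [hu, hxa]; module
  replace hh : h = (2 : K) • (y : D) - b • (1 : D) := by rw [hh, hyb]; module
  have huu : u * u = (a ^ 2 - 4) • (1 : D) := by
    rw [hu]
    simp only [mul_sub, sub_mul, smul_mul_assoc, mul_smul_comm, one_mul, mul_one, hxx]
    module
  have hhh : h * h = (b ^ 2 - 4) • (1 : D) := by
    rw [hh]
    simp only [mul_sub, sub_mul, smul_mul_assoc, mul_smul_comm, one_mul, mul_one, hyy]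
    module
  have huh : h * u = (4 * c - 2 * a * b) • (1 : D) - u * h := by
    rw [hu, hh]
    simp only [mul_sub, sub_mul, smul_mul_assoc, mul_smul_comm, one_mul, mul_one, hyx]
    module
  obtain ⟨A, hA⟩ : ∃ A, A = a ^ 2 - 4 := ⟨_, rfl⟩
  obtain ⟨B, hB⟩ : ∃ B, B = 4 * c - 2 * a * b := ⟨_, rfl⟩
  have hA0 : A < 0 := by rw [hA]; rcases ha with rfl | rfl | rfl <;> norm_num
  rw [← hA] at huu
  rw [← hB] at huh
  obtain ⟨v, hv⟩ : ∃ v : D, v = (2 * A) • h - B • u := ⟨_, rfl⟩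
  have hvV : v ∈ V := hv ▸ V.sub_mem (V.smul_mem _ hhV) (V.smul_mem _ huV)
  have huv : v * u = -(u * v) := by
    rw [hv]
    simp only [mul_sub, sub_mul, smul_mul_assoc, mul_smul_comm, huu, huh]
    module
  have hvv : v * v = (A * (4 * A * (b ^ 2 - 4) - B ^ 2)) • (1 : D) := by
    rw [hv]
    simp only [mul_sub, sub_mul, smul_mul_assoc, mul_smul_comm, huu, huh, hhh]
    module
  have hle : A * (4 * A * (b ^ 2 - 4) - B ^ 2) ≤ 0 := by
    refine mul_nonpos_of_nonpos_of_nonneg hA0.le ?_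
    rw [hA, hB]
    rcases ha with rfl | rfl | rfl <;> rcases hb with rfl | rfl | rfl <;>
      rcases hc with rfl | rfl | rfl <;> norm_num
  have hne : A * (4 * A * (b ^ 2 - 4) - B ^ 2) ≠ 0 := by
    intro h0
    rw [h0, zero_smul, mul_self_eq_zero, hv, sub_eq_zero] at hvv
    have hcomm : u * h = h * u := by
      have h2A : (2 * A) ≠ 0 := mul_ne_zero two_ne_zero hA0.ne
      have : h = ((2 * A)⁻¹ * B) • u := by rw [mul_smul, ← hvv, inv_smul_smul₀ h2A]
      rw [this, mul_smul_comm, smul_mul_assoc]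
    rw [hu, hh] at hcomm
    simp only [mul_sub, sub_mul, smul_mul_assoc, mul_smul_comm, one_mul, mul_one] at hcomm
    refine hxy (smul_right_injective D (four_ne_zero (α := K)) ?_)
    refine sub_eq_zero.1 (Eq.trans ?_ (sub_eq_zero.2 hcomm))
    module
  have hlt := lt_of_le_of_ne hle hne
  obtain ⟨hcen, e, he⟩ := exists_ringEquiv_quaternion hA0 hlt huu hvv huv
    (mem_span_quaternion_basis hV hD huV hvV hA0.ne hne huu hvv huv)
  exact ⟨A, _, hA0, hlt, hcen, e, he⟩

end Quaternion

/-- Let `G` be a finite cut group, `D` a finite-dimensional division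
`ℚ`-algebra and `π : ℚG → D` a surjective `ℚ`-algebra homomorphism. Then either `D` is
commutative, or the center of `D` is a totally real number field `K` and `D ≅ ℍ[K,a,b]`
as `K`-algebras for some totally negative `a, b ∈ K`. -/
theorem simple_quotient_of_cut_group_comm_or_totally_definite_quaternion
    (G : Type*) [Group G] [Finite G]
    (hcut : Finite (↥(Subring.center (MonoidAlgebra ℤ G)))ˣ)
    (D : Type*) [DivisionRing D] [Algebra ℚ D] [FiniteDimensional ℚ D]
    (π : MonoidAlgebra ℚ G →ₐ[ℚ] D) (hπ : Function.Surjective π) :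
    (∀ x y : D, x * y = y * x) ∨
    ∃ (K : Type) (_ : Field K) (_ : Algebra ℚ K) (_ : FiniteDimensional ℚ K)
      (ι : K →+* D) (a b : K),
        Set.range ι = Set.center D ∧
        (∀ σ : K →+* ℂ, ∀ x : K, (σ x).im = 0) ∧
        (∀ σ : K →+* ℝ, σ a < 0 ∧ σ b < 0) ∧
        ∃ e : D ≃+* ℍ[K, a, b], ∀ c : K, e (ι c) = algebraMap K ℍ[K, a, b] c := by
  have : CharZero D := algebraRat.charZero D
  let f : G →* Dˣ := ((π : MonoidAlgebra ℚ G →* D).comp (MonoidAlgebra.of ℚ G)).toHomUnits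
  have : Finite f.range := Set.finite_range f
  have hspan : Submodule.span ℚ (Units.val '' (f.range : Set Dˣ)) = (⊤ : Submodule ℚ D) := by
    refine Submodule.eq_top_iff'.2 fun d => ?_
    obtain ⟨p, rfl⟩ := hπ d
    induction p using MonoidAlgebra.induction_on with
    | of g => exact Submodule.subset_span ⟨f g, ⟨g, rfl⟩, rfl⟩
    | add p q hp hq => rw [map_add]; exact Submodule.add_mem _ hp hq
    | smul r p hp => rw [map_smul]; exact Submodule.smul_mem _ r hp
  refine (comm_or_exists_ringEquiv_quaternion
    (fun x hx => eq_or_add_inv_mem_of_powConj (powConj_range hcut f) hx) hspan).imp_right ?_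
  rintro ⟨α, β, hα, hβ, hcenter, e, he⟩
  exact ⟨ℚ, inferInstance, inferInstance, inferInstance, algebraMap ℚ D, α, β, hcenter,
    fun σ x => by simp [eq_ratCast σ x],
    fun σ => ⟨by rw [eq_ratCast σ α]; exact_mod_cast hα,
      by rw [eq_ratCast σ β]; exact_mod_cast hβ⟩, e, he⟩
end

section
/- Let G be a finite cut group. Then there exists a surjective ℚ-algebra homomorphism from the rational group algebra ℚG onto the 2×2 matrix algebra M₂(ℚ) if and only if there exists a surjective group homomorphism from G onto the dihedral group of order 8 or onto the symmetric group S₃ on three letters. -/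
namespace DihedralGroup

variable {K : Type*} [Group K] {n : ℕ} {g s : K}

theorem zpow_eq_zpow_of_intCast_eq (hg : g ^ n = 1) {i j : ℤ}
    (h : (i : ZMod n) = (j : ZMod n)) : g ^ i = g ^ j := by
  rw [zpow_eq_zpow_iff_modEq]
  exact ((ZMod.intCast_eq_intCast_iff _ _ _).1 h).of_dvd
    (Int.natCast_dvd_natCast.2 (orderOf_dvd_of_pow_eq_one hg))

theorem mul_zpow_eq (hs : s * s = 1) (hsg : s * g * s = g⁻¹) (i : ℤ) :
    g ^ i * s = s * g ^ (-i) := by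
  have h : SemiconjBy s g⁻¹ g := by
    rw [SemiconjBy, ← hsg]
    simp only [← mul_assoc, hs, one_mul]
  simpa using! (h.zpow_right i).eq.symm

/-- The homomorphism from the dihedral group given by a pair of elements satisfying the defining
relations of the standard generators. -/
def lift (hg : g ^ n = 1) (hs : s * s = 1) (hsg : s * g * s = g⁻¹) : DihedralGroup n →* K where
  toFun
    | r i => g ^ (i.cast : ℤ)
    | sr i => s * g ^ (i.cast : ℤ)
  map_one' := by
    rw [one_def, ← zpow_zero g]
    exact zpow_eq_zpow_of_intCast_eq hg (by simp)
  map_mul' := by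
    rintro (i | i) (j | j)
    · simp only [r_mul_r, ← zpow_add]
      exact zpow_eq_zpow_of_intCast_eq hg (by simp)
    · simp only [r_mul_sr]
      rw [← mul_assoc, mul_zpow_eq hs hsg, mul_assoc, ← zpow_add]
      exact congrArg _ (zpow_eq_zpow_of_intCast_eq hg (by simp; ring))
    · simp only [sr_mul_r, mul_assoc, ← zpow_add]
      exact congrArg _ (zpow_eq_zpow_of_intCast_eq hg (by simp))
    · simp only [sr_mul_sr]
      rw [mul_assoc, ← mul_assoc _ s, mul_zpow_eq hs hsg, ← mul_assoc, ← mul_assoc, hs, one_mul,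
        ← zpow_add]
      exact zpow_eq_zpow_of_intCast_eq hg (by simp; ring)

variable (hg : g ^ n = 1) (hs : s * s = 1) (hsg : s * g * s = g⁻¹)

theorem lift_r_intCast (i : ℤ) : lift hg hs hsg (r i) = g ^ i :=
  zpow_eq_zpow_of_intCast_eq hg (by simp)

theorem lift_sr_intCast (i : ℤ) : lift hg hs hsg (sr i) = s * g ^ i :=
  congrArg (s * ·) (zpow_eq_zpow_of_intCast_eq hg (by simp))

theorem lift_surjective (h : ∀ x : K, ∃ i : ℤ, x = g ^ i ∨ x = s * g ^ i) :
    Function.Surjective (lift hg hs hsg) := by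
  intro x
  obtain ⟨i, rfl | rfl⟩ := h x
  · exact ⟨r i, lift_r_intCast ..⟩
  · exact ⟨sr i, lift_sr_intCast ..⟩

/-- A group generated by an element `g` and an involution inverting it, not a power of `g`,
is dihedral. -/
theorem nonempty_mulEquiv (hs : s * s = 1) (hsg : s * g * s = g⁻¹)
    (hs' : s ∉ Subgroup.zpowers g) (h : ∀ x : K, ∃ i : ℤ, x = g ^ i ∨ x = s * g ^ i) :
    Nonempty (DihedralGroup (orderOf g) ≃* K) := by
  refine ⟨MulEquiv.ofBijective (lift (pow_orderOf_eq_one g) hs hsg)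
    ⟨(injective_iff_map_eq_one _).2 ?_, lift_surjective _ _ _ h⟩⟩
  rintro (i | i) hi <;> obtain ⟨i, rfl⟩ := ZMod.intCast_surjective i
  · rw [lift_r_intCast, ← orderOf_dvd_iff_zpow_eq_one, ← ZMod.intCast_zmod_eq_zero_iff_dvd] at hi
    rw [hi, r_zero]
  · rw [lift_sr_intCast, mul_eq_one_iff_eq_inv, ← zpow_neg] at hi
    exact (hs' ⟨-i, hi.symm⟩).elim

/-- The surjection onto `S₃` of a dihedral group of order `2 * n` with `3 ∣ n`. -/
theorem exists_surjective_perm_three (hn : 3 ∣ n) :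
    ∃ f : DihedralGroup n →* Equiv.Perm (Fin 3), Function.Surjective f := by
  have h3 : (finRotate 3) ^ 3 = 1 := by decide
  refine ⟨lift (g := finRotate 3) (s := Equiv.swap 0 1)
    (orderOf_dvd_iff_pow_eq_one.1 ((orderOf_dvd_of_pow_eq_one h3).trans hn)) (by decide)
    (by decide), lift_surjective _ _ _ fun x ↦ ?_⟩
  have : ∀ x : Equiv.Perm (Fin 3), ∃ i : Fin 3,
    x = finRotate 3 ^ (i : ℕ) ∨ x = Equiv.swap 0 1 * finRotate 3 ^ (i : ℕ) := by decide
  obtain ⟨i, hi⟩ := this x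
  exact ⟨(i : ℕ), by simpa only [zpow_natCast] using hi⟩

/-- The isomorphism type of `S₃` as a dihedral group. -/
theorem nonempty_mulEquiv_perm_three : Nonempty (DihedralGroup 3 ≃* Equiv.Perm (Fin 3)) := by
  obtain ⟨f, hf⟩ := exists_surjective_perm_three (dvd_refl 3)
  refine ⟨MulEquiv.ofBijective f (hf.bijective_of_nat_card_le ?_)⟩
  rw [DihedralGroup.nat_card, Nat.card_perm, Nat.card_fin]
  decide

end DihedralGroup

section MatrixTwo

open Matrix

/-- A finite group of rational `2 × 2` matrices preserves a positive definite quadratic form. -/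
theorem exists_invariant_form {K : Type*} [Group K] [Finite K]
    (ρ : K →* Matrix (Fin 2) (Fin 2) ℚ) :
    ∃ a b c : ℚ, 0 < a ∧ 0 < a * c - b ^ 2 ∧
      ∀ k, (ρ k)ᵀ * !![a, b; b, c] * ρ k = !![a, b; b, c] := by
  have := Fintype.ofFinite K
  set Q : Matrix (Fin 2) (Fin 2) ℚ := ∑ k, (ρ k)ᵀ * ρ k with hQ
  have hinv (k : K) : (ρ k)ᵀ * Q * ρ k = Q := by
    rw [hQ, Matrix.mul_sum, Matrix.sum_mul]
    refine Fintype.sum_equiv (Equiv.mulRight k) _ _ fun x ↦ ?_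
    simp [Matrix.mul_assoc]
  have hpos (v : Fin 2 → ℚ) (hv : v ≠ 0) : 0 < v ⬝ᵥ Q *ᵥ v := by
    have h (k : K) : v ⬝ᵥ ((ρ k)ᵀ * ρ k) *ᵥ v = (ρ k *ᵥ v) ⬝ᵥ (ρ k *ᵥ v) := by
      rw [← Matrix.mulVec_mulVec, Matrix.dotProduct_mulVec, Matrix.vecMul_transpose]
    rw [hQ, Matrix.sum_mulVec, dotProduct_sum]
    refine Finset.sum_pos' (fun k _ ↦ ?_) ⟨1, Finset.mem_univ _, ?_⟩
    · rw [h]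
      exact Finset.sum_nonneg fun i _ ↦ mul_self_nonneg _
    · rw [h, map_one, Matrix.one_mulVec]
      exact lt_of_le_of_ne (Finset.sum_nonneg fun i _ ↦ mul_self_nonneg _)
        fun h0 ↦ hv (dotProduct_self_eq_zero.1 h0.symm)
  have hsymm : Q 1 0 = Q 0 1 := by
    simp [hQ, Matrix.sum_apply, Matrix.mul_apply, mul_comm]
  have hQe : Q = !![Q 0 0, Q 0 1; Q 0 1, Q 1 1] := by
    rw [Matrix.eta_fin_two Q, hsymm]
    simp
  have ha : 0 < Q 0 0 := by
    have := hpos ![1, 0] (by simp)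
    rw [hQe] at this
    simpa [Matrix.mulVec, dotProduct, Fin.sum_univ_two] using this
  refine ⟨Q 0 0, Q 0 1, Q 1 1, ha, ?_, fun k ↦ by rw [← hQe]; exact hinv k⟩
  have := hpos ![-Q 0 1, Q 0 0] (by simp [ha.ne'])
  rw [hQe] at this
  simp [Matrix.mulVec, dotProduct, Fin.sum_univ_two] at this
  nlinarith

variable {a b c : ℚ} {M : Matrix (Fin 2) (Fin 2) ℚ}

theorem det_eq_one_or_neg_one_of_form (hq : 0 < a * c - b ^ 2)
    (h : Mᵀ * !![a, b; b, c] * M = !![a, b; b, c]) : M.det = 1 ∨ M.det = -1 := by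
  have h2 := congrArg Matrix.det h
  rw [Matrix.det_mul, Matrix.det_mul, Matrix.det_transpose, Matrix.det_fin_two_of] at h2
  rw [← mul_self_eq_one_iff]
  refine mul_right_cancel₀ hq.ne' ?_
  linear_combination h2

theorem entries_of_form_of_det_eq_one
    (h : Mᵀ * !![a, b; b, c] * M = !![a, b; b, c]) (hd : M.det = 1) :
    a * M 0 0 = a * M 1 1 - 2 * b * M 1 0 ∧ a * M 0 1 = - c * M 1 0 := by
  have h2 : M.adjugateᵀ * (Mᵀ * !![a, b; b, c] * M) = !![a, b; b, c] * M := by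
    rw [Matrix.mul_assoc, ← Matrix.mul_assoc, ← Matrix.transpose_mul, Matrix.mul_adjugate, hd]
    simp
  rw [h, Matrix.adjugate_fin_two, ← Matrix.ext_iff] at h2
  have h00 := h2 0 0
  have h01 := h2 0 1
  have h10 := h2 1 0
  simp [Matrix.mul_apply, Fin.sum_univ_two] at h00 h01 h10
  constructor <;> linarith

theorem trace_eq_zero_of_form_of_det_eq_neg_one (ha : 0 < a)
    (h : Mᵀ * !![a, b; b, c] * M = !![a, b; b, c]) (hd : M.det = -1) :
    M 0 0 = - M 1 1 := by
  have h2 : M.adjugateᵀ * (Mᵀ * !![a, b; b, c] * M) = -(!![a, b; b, c] * M) := by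
    rw [Matrix.mul_assoc, ← Matrix.mul_assoc, ← Matrix.transpose_mul, Matrix.mul_adjugate, hd]
    simp
  rw [h, Matrix.adjugate_fin_two, ← Matrix.ext_iff] at h2
  have h00 := h2 0 0
  simp [Matrix.mul_apply, Fin.sum_univ_two, Matrix.vecMul, dotProduct] at h00
  have : a * (M 0 0 + M 1 1) = 0 := by linarith
  have := (mul_eq_zero.1 this).resolve_left ha.ne'
  linarith

/-- A finite group of rational `2 × 2` matrices of determinant one is cyclic, and its elements
have order dividing `4` or `6`. -/
theorem isCyclic_of_det_eq_one {N : Type*} [Group N] [Finite N]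
    (ρ : N →* Matrix (Fin 2) (Fin 2) ℚ) (hρ : Function.Injective ρ)
    (hdet : ∀ k, (ρ k).det = 1) : IsCyclic N ∧ ∀ k : N, k ^ 4 = 1 ∨ k ^ 6 = 1 := by
  obtain ⟨a, b, c, ha, hq, hform⟩ := exists_invariant_form ρ
  have h0 (k : N) : ρ k 0 0 = ρ k 1 1 - 2 * b / a * ρ k 1 0 := by
    have := (entries_of_form_of_det_eq_one (hform k) (hdet k)).1
    field_simp
    linarith
  have h1 (k : N) : ρ k 0 1 = - c / a * ρ k 1 0 := by
    have := (entries_of_form_of_det_eq_one (hform k) (hdet k)).2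
    field_simp
    linarith
  obtain ⟨w, hw⟩ : ∃ w : ℝ, w ^ 2 = a * c - b ^ 2 :=
    ⟨√(a * c - b ^ 2), Real.sq_sqrt (by exact_mod_cast hq.le)⟩
  have hw0 : w ≠ 0 := by
    rintro rfl
    have : (a * c - b ^ 2 : ℝ) ≠ 0 := by exact_mod_cast hq.ne'
    simp [← hw] at this
  have ha' : (a : ℝ) ≠ 0 := by exact_mod_cast ha.ne'
  have hmul0 (k l : N) : ρ (k * l) 1 0 = ρ k 1 0 * ρ l 0 0 + ρ k 1 1 * ρ l 1 0 := by
    simp [Matrix.mul_apply]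
  have hmul1 (k l : N) : ρ (k * l) 1 1 = ρ k 1 0 * ρ l 0 1 + ρ k 1 1 * ρ l 1 1 := by
    simp [Matrix.mul_apply]
  -- the eigenvalue on a common eigenvector
  let χ : N →* ℂ :=
    { toFun k := ⟨ρ k 1 1 - ρ k 1 0 * b / a, ρ k 1 0 / a * w⟩
      map_one' := by apply Complex.ext <;> simp
      map_mul' k l := by
        apply Complex.ext
        · simp only [Complex.mul_re, hmul0, hmul1, h0, h1]
          push_cast
          field_simp
          linear_combination (ρ k 1 0 * ρ l 1 0 : ℝ) * hw
        · simp only [Complex.mul_im, hmul0, h0]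
          push_cast
          field_simp
          ring }
  have hχre (k : N) : (χ k).re = ρ k 1 1 - ρ k 1 0 * b / a := rfl
  have hχim (k : N) : (χ k).im = ρ k 1 0 / a * w := rfl
  have hχ : Function.Injective χ := by
    intro k l h
    have him := congrArg Complex.im h
    have hre := congrArg Complex.re h
    rw [hχim, hχim, mul_left_inj' hw0, div_left_inj' ha', Rat.cast_inj] at him
    rw [hχre, hχre, him, sub_left_inj, Rat.cast_inj] at hre
    refine hρ (Matrix.ext fun i j ↦ ?_)
    fin_cases i <;> fin_cases j <;> simp [h0, h1, him, hre]
  refine ⟨isCyclic_of_injective_ringHom χ hχ, fun k ↦ ?_⟩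
  have hnorm : (χ k).re ^ 2 + (χ k).im ^ 2 = 1 := by
    have h := hdet k
    rw [Matrix.det_fin_two, h0, h1] at h
    have h' := congrArg (Rat.cast : ℚ → ℝ) h
    push_cast at h'
    rw [hχre, hχim, ← h']
    field_simp
    linear_combination (ρ k 1 0 : ℝ) ^ 2 * hw
  have hint (l : N) : IsIntegral ℤ (χ l) :=
    .of_pow (orderOf_pos l) (by rw [← map_pow, pow_orderOf_eq_one, map_one]; exact isIntegral_one)
  have hinv : χ k⁻¹ = (starRingEnd ℂ) (χ k) := by
    have h1 : χ k * χ k⁻¹ = 1 := by rw [← map_mul, mul_inv_cancel, map_one]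
    have h2 : χ k * (starRingEnd ℂ) (χ k) = 1 := by
      rw [Complex.mul_conj, Complex.normSq_apply, ← sq, ← sq, hnorm, Complex.ofReal_one]
    exact mul_left_cancel₀ (left_ne_zero_of_mul_eq_one h1) (h1.trans h2.symm)
  have htr : χ k + χ k⁻¹ = ((ρ k).trace : ℚ) := by
    rw [hinv, Complex.add_conj, hχre, Matrix.trace_fin_two, h0]
    push_cast
    ring
  obtain ⟨m, hm⟩ := ((hint k).add (hint k⁻¹)).exists_int_iff_exists_rat.1 ⟨_, htr⟩
  have hchar : χ k ^ 2 = m * χ k - 1 := by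
    rw [← hm, add_mul, ← map_mul χ k⁻¹, inv_mul_cancel, map_one]
    ring
  have hm2 : m ^ 2 ≤ 4 := by
    have hre : 2 * (χ k).re = m := by
      rw [hinv, Complex.add_conj] at hm
      exact_mod_cast hm
    have : (m : ℝ) ^ 2 ≤ 4 := by
      rw [← hre]
      nlinarith [sq_nonneg (χ k).im]
    exact_mod_cast this
  have hlb : -2 ≤ m := by nlinarith
  have hub : m ≤ 2 := by nlinarith
  have hpow (n : ℕ) (h : χ k ^ n = 1) : k ^ n = 1 := hχ (by rw [map_pow, h, map_one])
  generalize χ k = z at hchar hpow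
  interval_cases m <;> push_cast at hchar
  · have : z = -1 := by
      have : (z + 1) ^ 2 = 0 := by linear_combination hchar
      linear_combination pow_eq_zero_iff two_ne_zero |>.1 this
    exact .inl (hpow 4 (by rw [this]; norm_num))
  · exact .inr (hpow 6 (by linear_combination (z ^ 4 - z ^ 3 + z - 1) * hchar))
  · exact .inl (hpow 4 (by linear_combination (z ^ 2 - 1) * hchar))
  · exact .inr (hpow 6 (by linear_combination (z ^ 4 + z ^ 3 - z - 1) * hchar))
  · have : z = 1 := by
      have : (z - 1) ^ 2 = 0 := by linear_combination hchar
      linear_combination pow_eq_zero_iff two_ne_zero |>.1 this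
    exact .inl (hpow 4 (by rw [this]; norm_num))

/-- A finite absolutely irreducible group of rational `2 × 2` matrices is dihedral of order
`6`, `8` or `12`. -/
theorem nonempty_dihedralGroup_mulEquiv {K : Type*} [Group K] [Finite K]
    (ρ : K →* Matrix (Fin 2) (Fin 2) ℚ) (hρ : Function.Injective ρ)
    (hirr : ∀ B, (∀ k, Commute (ρ k) B) → B ∈ Set.range (Matrix.scalar (Fin 2))) :
    ∃ n : ℕ, (n = 3 ∨ n = 4 ∨ n = 6) ∧ Nonempty (DihedralGroup n ≃* K) := by
  obtain ⟨a, b, c, ha, hq, hform⟩ := exists_invariant_form ρ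
  have hdet (k : K) := det_eq_one_or_neg_one_of_form hq (hform k)
  obtain ⟨s, hs⟩ : ∃ s, (ρ s).det = -1 := by
    by_contra! hne
    have hcomm (k : K) : Commute (ρ k) !![-b, -c; a, b] := by
      obtain ⟨h1, h2⟩ := entries_of_form_of_det_eq_one (hform k) ((hdet k).resolve_right (hne k))
      rw [commute_iff_eq, ← Matrix.ext_iff]
      simp only [Fin.forall_fin_two, Matrix.mul_apply, Fin.sum_univ_two, Matrix.of_apply,
        Matrix.cons_val', Matrix.cons_val_zero, Matrix.cons_val_one, Matrix.cons_val_fin_one]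
      refine ⟨⟨by linarith, ?_⟩, by linarith, by linarith⟩
      refine mul_left_cancel₀ ha.ne' ?_
      linear_combination (-c) * h1 + 2 * b * h2
    obtain ⟨x, hx⟩ := hirr _ hcomm
    have := congrFun (congrFun hx 1) 0
    simp at this
    exact ha.ne this
  have hinvol {k : K} (hk : (ρ k).det = -1) : k * k = 1 := by
    have h := trace_eq_zero_of_form_of_det_eq_neg_one ha (hform k) hk
    refine hρ ?_
    rw [Matrix.det_fin_two, h] at hk
    rw [map_mul, map_one, ← Matrix.ext_iff]
    simp only [Fin.forall_fin_two, Matrix.mul_apply, Fin.sum_univ_two, h, Matrix.one_apply_eq,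
      Matrix.one_apply_ne zero_ne_one, Matrix.one_apply_ne one_ne_zero]
    refine ⟨⟨by linarith, by ring⟩, by ring, by linarith⟩
  let N : Subgroup K := (Matrix.detMonoidHom.comp ρ).ker
  have hmem {k : K} : k ∈ N ↔ (ρ k).det = 1 := Iff.rfl
  obtain ⟨⟨⟨g, hgN⟩, hg⟩, hpow⟩ := isCyclic_of_det_eq_one (ρ.comp N.subtype)
    (hρ.comp N.subtype_injective) fun k ↦ hmem.1 k.2
  have hgen {x : K} (hx : x ∈ N) : ∃ i : ℤ, x = g ^ i := by
    obtain ⟨i, hi⟩ := hg ⟨x, hx⟩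
    exact ⟨i, (congrArg Subtype.val hi).symm⟩
  have hss := hinvol hs
  have hsinv : s⁻¹ = s := inv_eq_of_mul_eq_one_left hss
  have hsg : s * g * s = g⁻¹ := by
    refine eq_inv_of_mul_eq_one_left ?_
    rw [mul_assoc]
    exact hinvol (by rw [map_mul, Matrix.det_mul, hs, hmem.1 hgN, mul_one])
  have hsN : s ∉ Subgroup.zpowers g := fun h ↦ by
    have := hmem.1 (Subgroup.zpowers_le.2 hgN h)
    rw [hs] at this
    norm_num at this
  have hall (x : K) : ∃ i : ℤ, x = g ^ i ∨ x = s * g ^ i := by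
    obtain hx | hx := hdet x
    · exact (hgen hx).imp fun _ ↦ .inl
    · obtain ⟨i, hi⟩ := hgen (x := s * x) (hmem.2 (by simp [hx, hs]))
      exact ⟨i, .inr (by rw [← hi, ← mul_assoc, hss, one_mul])⟩
  have hord : ¬ orderOf g ∣ 2 := fun h ↦ by
    have hg2 : g⁻¹ = g := inv_eq_of_mul_eq_one_left (by
      rw [← sq, orderOf_dvd_iff_pow_eq_one.1 h])
    have hc : Commute g s := by
      rw [hg2] at hsg
      calc g * s = s * g * s * s := by rw [hsg]
        _ = s * g := by rw [mul_assoc, hss, mul_one]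
    have hcs (x : K) : Commute x s := by
      obtain ⟨i, rfl | rfl⟩ := hall x
      · exact hc.zpow_left i
      · exact (Commute.refl s).mul_left (hc.zpow_left i)
    obtain ⟨x, hx⟩ := hirr (ρ s) fun k ↦ (hcs k).map ρ
    rw [← hx] at hs
    simp at hs
    nlinarith
  refine ⟨orderOf g, ?_, DihedralGroup.nonempty_mulEquiv hss hsg hsN hall⟩
  have h46 : orderOf g ∣ 4 ∨ orderOf g ∣ 6 := (hpow ⟨g, hgN⟩).imp
    (fun h ↦ orderOf_dvd_of_pow_eq_one (congrArg Subtype.val h))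
    (fun h ↦ orderOf_dvd_of_pow_eq_one (congrArg Subtype.val h))
  have hle : orderOf g ≤ 6 := h46.elim (fun h ↦ (Nat.le_of_dvd (by norm_num) h).trans (by norm_num))
    (Nat.le_of_dvd (by norm_num))
  interval_cases orderOf g <;> simp_all

/-- A pair of matrices satisfying the relations of a dihedral group and spanning `M₂(ℚ)` exhibits
`M₂(ℚ)` as a quotient of the group algebra of any group mapping onto the dihedral group. -/
theorem exists_surjective_of_dihedralGroup {G : Type*} [Group G] {n : ℕ}
    {f : G →* DihedralGroup n} (hf : Function.Surjective f) {R S : (Matrix (Fin 2) (Fin 2) ℚ)ˣ}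
    (hR : R ^ n = 1) (hS : S * S = 1) (hSR : S * R * S = R⁻¹)
    (hspan : ∀ M : Matrix (Fin 2) (Fin 2) ℚ, ∃ x y z w : ℚ,
      M = x • 1 + y • R.val + z • S.val + w • (R.val * S.val)) :
    ∃ π : MonoidAlgebra ℚ G →ₐ[ℚ] Matrix (Fin 2) (Fin 2) ℚ, Function.Surjective π := by
  let φ : DihedralGroup n →* (Matrix (Fin 2) (Fin 2) ℚ)ˣ := DihedralGroup.lift hR hS hSR
  let π := MonoidAlgebra.lift ℚ (Matrix (Fin 2) (Fin 2) ℚ) G ((Units.coeHom _).comp (φ.comp f))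
  have hmem (d : DihedralGroup n) : (φ d).val ∈ π.range := by
    obtain ⟨g, rfl⟩ := hf d
    exact ⟨MonoidAlgebra.single g 1, by simp [π]⟩
  have hRmem : R.val ∈ π.range := by
    have h := hmem (.r (1 : ℤ))
    rwa [DihedralGroup.lift_r_intCast, zpow_one] at h
  have hSmem : S.val ∈ π.range := by
    have h := hmem (.sr (0 : ℤ))
    rwa [DihedralGroup.lift_sr_intCast, zpow_zero, mul_one] at h
  refine ⟨π, fun M ↦ ?_⟩
  obtain ⟨x, y, z, w, rfl⟩ := hspan M
  exact add_mem (add_mem (add_mem (π.range.smul_mem (one_mem _) x) (π.range.smul_mem hRmem y))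
    (π.range.smul_mem hSmem z)) (π.range.smul_mem (mul_mem hRmem hSmem) w)

theorem exists_surjective_of_dihedralGroup_four {G : Type*} [Group G]
    {f : G →* DihedralGroup 4} (hf : Function.Surjective f) :
    ∃ π : MonoidAlgebra ℚ G →ₐ[ℚ] Matrix (Fin 2) (Fin 2) ℚ, Function.Surjective π := by
  refine exists_surjective_of_dihedralGroup hf
    (R := ⟨!![0, -1; 1, 0], !![0, 1; -1, 0], by simp [Matrix.one_fin_two],
      by simp [Matrix.one_fin_two]⟩)
    (S := ⟨!![1, 0; 0, -1], !![1, 0; 0, -1], by simp [Matrix.one_fin_two],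
      by simp [Matrix.one_fin_two]⟩)
    (Units.ext ?_) (Units.ext ?_) (Units.ext ?_) fun M ↦ ⟨(M 0 0 + M 1 1) / 2,
      (M 1 0 - M 0 1) / 2, (M 0 0 - M 1 1) / 2, (M 1 0 + M 0 1) / 2, ?_⟩
  · simp [pow_succ, Matrix.one_fin_two]
  · simp [Matrix.one_fin_two]
  · simp
  · ext i j
    fin_cases i <;> fin_cases j <;> simp <;> ring

theorem exists_surjective_of_dihedralGroup_three {G : Type*} [Group G]
    {f : G →* DihedralGroup 3} (hf : Function.Surjective f) :
    ∃ π : MonoidAlgebra ℚ G →ₐ[ℚ] Matrix (Fin 2) (Fin 2) ℚ, Function.Surjective π := by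
  refine exists_surjective_of_dihedralGroup hf
    (R := ⟨!![0, -1; 1, -1], !![-1, 1; -1, 0], by simp [Matrix.one_fin_two],
      by simp [Matrix.one_fin_two]⟩)
    (S := ⟨!![0, 1; 1, 0], !![0, 1; 1, 0], by simp [Matrix.one_fin_two],
      by simp [Matrix.one_fin_two]⟩)
    (Units.ext ?_) (Units.ext ?_) (Units.ext ?_) fun M ↦ ?_
  · simp [pow_succ, Matrix.one_fin_two]
  · simp [Matrix.one_fin_two]
  · simp
  · obtain ⟨p, hp⟩ : ∃ p, p = M 1 1 - M 0 0 := ⟨_, rfl⟩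
    obtain ⟨q, hq⟩ : ∃ q, q = M 1 0 - M 0 1 := ⟨_, rfl⟩
    refine ⟨M 0 0 + (2 * p + q) / 3, (p + 2 * q) / 3, M 0 1 + (p + 2 * q) / 3, (2 * p + q) / 3, ?_⟩
    ext i j
    fin_cases i <;> fin_cases j <;> simp [hp, hq] <;> ring

/-- If `ℚG` maps onto `M₂(ℚ)`, then the image of `G` is dihedral of order `6`, `8` or `12`. -/
theorem exists_surjective_dihedralGroup {G : Type*} [Group G] [Finite G]
    {π : MonoidAlgebra ℚ G →ₐ[ℚ] Matrix (Fin 2) (Fin 2) ℚ} (hπ : Function.Surjective π) :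
    ∃ n : ℕ, (n = 3 ∨ n = 4 ∨ n = 6) ∧ ∃ f : G →* DihedralGroup n, Function.Surjective f := by
  let ρ := ((MonoidAlgebra.lift ℚ (Matrix (Fin 2) (Fin 2) ℚ) G).symm π).toHomUnits
  have : Finite ρ.range := Set.finite_range ρ
  have hlift : MonoidAlgebra.lift ℚ _ G ((Units.coeHom _).comp ρ) = π :=
    (MonoidAlgebra.lift ℚ (Matrix (Fin 2) (Fin 2) ℚ) G).apply_symm_apply π
  obtain ⟨n, hn, ⟨e⟩⟩ := nonempty_dihedralGroup_mulEquiv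
    ((Units.coeHom _).comp ρ.range.subtype)
    (Units.val_injective.comp ρ.range.subtype_injective) fun B hB ↦ by
      refine Matrix.mem_range_scalar_of_commute_single fun i j _ ↦ ?_
      obtain ⟨x, hx⟩ := hπ (Matrix.single i j 1)
      rw [← hx, ← hlift, MonoidAlgebra.lift_apply]
      exact Commute.sum_left _ _ _ fun g _ ↦ (hB ⟨ρ g, g, rfl⟩).smul_left _
  exact ⟨n, hn, e.symm.toMonoidHom.comp ρ.rangeRestrict,
    e.symm.surjective.comp ρ.rangeRestrict_surjective⟩

end MatrixTwo

/-- Let `G` be a finite cut group. Then `ℚG` has `M₂(ℚ)` as a simple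
(epimorphic) component if and only if `G` maps onto the dihedral group of order 8 or onto
the symmetric group `S₃`. -/
theorem M2Q_component_iff_maps_onto_D8_or_S3
    (G : Type*) [Group G] [Finite G]
    (hcut : Finite (↥(Subring.center (MonoidAlgebra ℤ G)))ˣ) :
    (∃ π : MonoidAlgebra ℚ G →ₐ[ℚ] Matrix (Fin 2) (Fin 2) ℚ, Function.Surjective π) ↔
    ((∃ f : G →* DihedralGroup 4, Function.Surjective f) ∨
     (∃ f : G →* Equiv.Perm (Fin 3), Function.Surjective f)) := by
  constructor
  · rintro ⟨π, hπ⟩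
    obtain ⟨n, hn, f, hf⟩ := exists_surjective_dihedralGroup hπ
    by_cases h4 : n = 4
    · subst h4
      exact .inl ⟨f, hf⟩
    · obtain ⟨e, he⟩ := DihedralGroup.exists_surjective_perm_three (n := n) (by omega)
      exact .inr ⟨e.comp f, he.comp hf⟩
  · rintro (⟨f, hf⟩ | ⟨f, hf⟩)
    · exact exists_surjective_of_dihedralGroup_four hf
    · obtain ⟨e⟩ := DihedralGroup.nonempty_mulEquiv_perm_three
      exact exists_surjective_of_dihedralGroup_three
        (f := e.symm.toMonoidHom.comp f) (e.symm.surjective.comp hf)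
end
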